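/- For every w ∈ ℝ² with w ≠ (0,0), the Hausdorff distance d_H(Π(w), 𝒪_τ(R_λ(w))) between the level set Π(w) = {ξ ∈ ℝ² : 𝒫(ξ) = 𝒫(w)} and the return orbit of the lattice point R_λ(w) tends to 0 as λ → 0⁺. -/

import Mathlib

open Filter Topology

noncomputable def Fe (lam : ℝ) : Equiv.Perm (ℤ × ℤ) where
  toFun p := (⌊lam * p.1⌋ - p.2, p.1)
  invFun p := (p.2, ⌊lam * p.2⌋ - p.1)
  left_inv p := by simp
  right_inv p := by simp

noncomputable def pt (lam : ℝ) (p : ℤ × ℤ) : ℝ × ℝ := (lam * p.1, lam * p.2)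

noncomputable def wfield (q : ℝ × ℝ) : ℤ × ℤ := (2*⌊q.2⌋+1, -(2*⌊q.1⌋+1))

def vcond (lam : ℝ) (p : ℤ × ℤ) : Prop :=
  pt lam ((Fe lam ^ 4) p) - pt lam p
    = lam • ((((wfield (pt lam p)).1 : ℝ)), (((wfield (pt lam p)).2 : ℝ)))

/-- Euclidean distance from `z ∈ ℝ²` to the symmetry line `{(t,t)}`. -/
noncomputable def dline (z : ℝ × ℝ) : ℝ := |z.1 - z.2| / Real.sqrt 2

/-- The return domain `X`, described by lattice indices. -/
noncomputable def Xset (lam : ℝ) : Set (ℤ × ℤ) :=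
  {p | 0 ≤ p.1 ∧ 0 ≤ p.2 ∧
    dline (pt lam p) ≤ dline (pt lam ((Fe lam ^ 4) p)) ∧
    dline (pt lam p) < dline (pt lam ((Fe lam ^ (-4 : ℤ)) p))}

/-- The forward transit time `τ(z) = min{k ≥ 1 : F_λᵏ(z) ∈ X}`. -/
noncomputable def tauPlus (lam : ℝ) (p : ℤ × ℤ) : ℕ :=
  sInf {k : ℕ | 1 ≤ k ∧ (Fe lam ^ (k : ℤ)) p ∈ Xset lam}

/-- The backward transit time `τ₋(z) = min{k ≥ 0 : F_λ⁻ᵏ(z) ∈ X}`. -/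
noncomputable def tauMinus (lam : ℝ) (p : ℤ × ℤ) : ℕ :=
  sInf {k : ℕ | (Fe lam ^ (-(k : ℤ))) p ∈ Xset lam}

/-- The return orbit `𝒪_τ(z) = {F_λᵏ(z) : −τ₋(z) ≤ k ≤ τ(z)}` (lattice indices). -/
noncomputable def retOrbit (lam : ℝ) (p : ℤ × ℤ) : Set (ℤ × ℤ) :=
  {q | ∃ k : ℤ, -(tauMinus lam p : ℤ) ≤ k ∧ k ≤ (tauPlus lam p : ℤ) ∧ q = (Fe lam ^ k) p}

/-- The rescaled round-off `R_λ(w) = λ(⌊w₁/λ⌋, ⌊w₂/λ⌋)`, as a lattice index. -/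
noncomputable def Rlam (lam : ℝ) (w : ℝ × ℝ) : ℤ × ℤ := (⌊w.1 / lam⌋, ⌊w.2 / lam⌋)

noncomputable def mu2 (w : ℝ × ℝ) (lam : ℝ) : ℝ :=
  ({q | q ∈ retOrbit lam (Rlam lam w) ∧ vcond lam q} : Set (ℤ × ℤ)).ncard /
    (retOrbit lam (Rlam lam w)).ncard

/-- The piecewise-affine function `P(x) = ⌊x⌋² + (2⌊x⌋+1)(x − ⌊x⌋)`. -/
noncomputable def Pfun (x : ℝ) : ℝ := (⌊x⌋ : ℝ)^2 + (2*(⌊x⌋ : ℝ)+1)*(x - ⌊x⌋)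

/-- The piecewise-affine Hamiltonian `𝒫(x,y) = P(x) + P(y)`. -/
noncomputable def ham (z : ℝ × ℝ) : ℝ := Pfun z.1 + Pfun z.2

/-! ### The function `P` -/

lemma Pfun_eq (x : ℝ) : Pfun x = (2*(⌊x⌋:ℝ)+1)*x - ⌊x⌋*(⌊x⌋+1) := by
  unfold Pfun; ring

lemma Pfun_ge (x : ℝ) (n : ℤ) : (2*(n:ℝ)+1)*x - n*(n+1) ≤ Pfun x := by
  rw [Pfun_eq]
  have h1 := Int.floor_le x
  have h2 := Int.lt_floor_add_one x
  set a := ⌊x⌋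
  have key : 0 ≤ ((a:ℝ)-n)*(2*x - a - n - 1) := by
    rcases lt_trichotomy a n with h | h | h
    · have h' : (a:ℝ)+1 ≤ n := by exact_mod_cast h
      nlinarith
    · simp [h]
    · have h' : (n:ℝ)+1 ≤ a := by exact_mod_cast h
      apply mul_nonneg <;> linarith
  nlinarith

lemma Pfun_sub_le (x y : ℝ) : Pfun x - Pfun y ≤ (2*(⌊x⌋:ℝ)+1)*(x-y) := by
  have := Pfun_ge y ⌊x⌋
  rw [Pfun_eq x]; nlinarith

lemma Pfun_zero : Pfun 0 = 0 := by simp [Pfun]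

lemma Pfun_neg (x : ℝ) : Pfun (-x) = Pfun x := by
  have aux : ∀ x : ℝ, Pfun (-x) ≤ Pfun x := by
    intro x
    have h := Pfun_ge x (-⌊-x⌋-1)
    rw [Pfun_eq (-x)]
    push_cast at h
    nlinarith
  exact le_antisymm (aux x) (by simpa using aux (-x))

lemma Pfun_abs (x : ℝ) : Pfun |x| = Pfun x := by
  rcases abs_choice x with h | h <;> rw [h]
  exact Pfun_neg x

lemma Pfun_mono_sub {x y : ℝ} (hy : 0 ≤ y) (hxy : y ≤ x) : x - y ≤ Pfun x - Pfun y := by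
  have h := Pfun_sub_le y x
  have h0 : (0:ℝ) ≤ ⌊y⌋ := by exact_mod_cast Int.floor_nonneg.2 hy
  nlinarith

lemma abs_le_Pfun (x : ℝ) : |x| ≤ Pfun x := by
  have := Pfun_mono_sub le_rfl (abs_nonneg x)
  rw [Pfun_abs, Pfun_zero] at this; linarith

lemma abs_sub_le_Pfun {x y : ℝ} (hy : 0 ≤ y) (hx : 0 ≤ x) : |x - y| ≤ |Pfun x - Pfun y| := by
  rcases le_total y x with h | h
  · have := Pfun_mono_sub hy h
    rw [abs_of_nonneg (by linarith)]; exact this.trans (le_abs_self _)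
  · have := Pfun_mono_sub hx h
    rw [abs_sub_comm, abs_of_nonneg (by linarith), abs_sub_comm]; exact this.trans (le_abs_self _)

lemma Pfun_lip_aux {R : ℝ} {x : ℝ} (hx : |x| ≤ R + 1) : |2*(⌊x⌋:ℝ)+1| ≤ 2*R+3 := by
  have h1 := Int.floor_le x
  have h2 := Int.lt_floor_add_one x
  rw [abs_le] at hx ⊢
  constructor <;> linarith

lemma Pfun_lip {R x y : ℝ} (hx : |x| ≤ R+1) (hy : |y| ≤ R+1) :
    |Pfun x - Pfun y| ≤ (2*R+3)*|x-y| := by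
  have aux : ∀ x y : ℝ, |x| ≤ R+1 → Pfun x - Pfun y ≤ (2*R+3)*|x-y| := by
    intro x y hx
    calc _ ≤ _ := Pfun_sub_le x y
      _ ≤ |(2*(⌊x⌋:ℝ)+1)*(x-y)| := le_abs_self _
      _ = |2*(⌊x⌋:ℝ)+1| * |x-y| := abs_mul _ _
      _ ≤ _ := mul_le_mul_of_nonneg_right (Pfun_lip_aux hx) (abs_nonneg _)
  rw [abs_le]
  have h1 := aux x y hx
  have h2 := aux y x hy
  rw [abs_sub_comm y x] at h2
  constructor <;> linarith

lemma Pfun_affine {x y : ℝ} {a : ℤ} (hx : ⌊x⌋ = a) (hy : ⌊y⌋ = a) :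
    Pfun y - Pfun x = (2*(a:ℝ)+1)*(y-x) := by
  rw [Pfun_eq, Pfun_eq, hx, hy]; ring

lemma Pfun_continuousOn (R : ℝ) (hR : 0 ≤ R) : ContinuousOn Pfun (Set.Icc 0 R) := by
  have : LipschitzOnWith (⟨2*R+3, by positivity⟩ : NNReal) Pfun (Set.Icc 0 R) := by
    apply LipschitzOnWith.of_dist_le_mul
    intro x hx y hy
    rw [Real.dist_eq, Real.dist_eq]
    apply Pfun_lip <;> rw [abs_le] <;> constructor <;> linarith [hx.1, hx.2, hy.1, hy.2]
  exact this.continuousOn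

lemma ham_neg_left (x y : ℝ) : ham (-x, y) = ham (x, y) := by simp [ham, Pfun_neg]

/-- Points of small energy defect are close to the level set. -/
lemma near_level_aux {h ε : ℝ} (hε : 0 ≤ ε) (hεh : ε ≤ h) (x y : ℝ)
    (hxy : Pfun x ≤ Pfun y) (hH : |Pfun x + Pfun y - h| ≤ ε) :
    ∃ y', Pfun x + Pfun y' = h ∧ |y - y'| ≤ ε := by
  have hH' := abs_le.1 hH
  have hx0 : 0 ≤ Pfun x := (abs_nonneg x).trans (abs_le_Pfun x)
  have h0 : 0 ≤ h := hε.trans hεh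
  have hm : h - Pfun x ∈ Set.Icc (Pfun 0) (Pfun h) := by
    rw [Pfun_zero]
    have := abs_le_Pfun h
    rw [abs_of_nonneg h0] at this
    constructor <;> linarith
  obtain ⟨t, ht, hPt⟩ := intermediate_value_Icc h0 (Pfun_continuousOn h h0) hm
  have hd : |(|y|) - t| ≤ ε := by
    refine (abs_sub_le_Pfun ht.1 (abs_nonneg y)).trans ?_
    rw [Pfun_abs, hPt]
    have e : Pfun y - (h - Pfun x) = Pfun x + Pfun y - h := by ring
    rwa [e]
  rcases abs_choice y with hy | hy
  · exact ⟨t, by linarith, by rwa [hy] at hd⟩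
  · refine ⟨-t, by rw [Pfun_neg]; linarith, ?_⟩
    have e : y - -t = -(-y - t) := by ring
    rw [e, abs_neg, ← hy]; exact hd

lemma near_level {h ε : ℝ} (hε : 0 ≤ ε) (hεh : ε ≤ h) (q : ℝ × ℝ)
    (hH : |ham q - h| ≤ ε) : ∃ ξ : ℝ × ℝ, ham ξ = h ∧ dist q ξ ≤ ε := by
  obtain ⟨x, y⟩ := q
  simp only [ham] at hH
  rcases le_total (Pfun x) (Pfun y) with hxy | hxy
  · obtain ⟨y', h1, h2⟩ := near_level_aux hε hεh x y hxy hH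
    refine ⟨(x, y'), h1, ?_⟩
    simp [Prod.dist_eq, Real.dist_eq, h2]
  · obtain ⟨y', h1, h2⟩ := near_level_aux hε hεh y x hxy (by rwa [add_comm])
    refine ⟨(y', y), by simpa [ham, add_comm] using h1, ?_⟩
    simp [Prod.dist_eq, Real.dist_eq, h2]

/-! ### Floor-counting potential -/

/-- Sum of floors at lattice translates. -/
noncomputable def Phi (lam : ℝ) (N : ℕ) (X : ℝ) : ℤ :=
  ∑ j ∈ Finset.range (2*N+1), ⌊X + ((j:ℝ) - N)*lam⌋

lemma Phi_abs {lam : ℝ} {N R : ℕ} {X : ℝ} (h0 : 0 < lam) (hN : lam * N ≤ 1) (hX : |X| ≤ R+1) :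
    |Phi lam N X| ≤ (2*N+1)*(R+3) := by
  unfold Phi
  refine (Finset.abs_sum_le_sum_abs _ _).trans ?_
  have : ∀ j ∈ Finset.range (2*N+1), |⌊X + ((j:ℝ) - N)*lam⌋| ≤ (R+3 : ℤ) := by
    intro j hj
    have hj' : (j:ℝ) ≤ 2*N := by exact_mod_cast Nat.lt_succ_iff.1 (Finset.mem_range.1 hj)
    have hj0 : (0:ℝ) ≤ j := by positivity
    rw [abs_le] at hX
    have b1 : ((j:ℝ) - N)*lam ≤ 1 := by nlinarith
    have b2 : -1 ≤ ((j:ℝ) - N)*lam := by nlinarith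
    rw [abs_le]
    constructor
    · apply Int.le_floor.2; push_cast; linarith
    · apply Int.floor_le_iff.2 ; push_cast; linarith
  refine (Finset.sum_le_sum this).trans ?_
  simp

lemma Phi_dichotomy {lam : ℝ} {N : ℕ} {X X' : ℝ} (h0 : 0 < lam) (hX : X + lam ≤ X') :
    Phi lam N X + 1 ≤ Phi lam N X' ∨
    (Phi lam N X = Phi lam N X' ∧ ∃ b : ℤ, (∀ t, |t - X| ≤ N*lam → ⌊t⌋ = b) ∧
      (∀ t, |t - X'| ≤ N*lam → ⌊t⌋ = b)) := by
  have hterm : ∀ j ∈ Finset.range (2*N+1),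
      ⌊X + ((j:ℝ) - N)*lam⌋ ≤ ⌊X' + ((j:ℝ) - N)*lam⌋ := by
    intro j _
    apply Int.floor_mono; linarith
  by_cases hall : ∀ j ∈ Finset.range (2*N+1),
      ⌊X + ((j:ℝ) - N)*lam⌋ = ⌊X' + ((j:ℝ) - N)*lam⌋
  · right
    refine ⟨Finset.sum_congr rfl hall, ⌊X + ((0:ℝ) - N)*lam⌋, ?_⟩
    have hind : ∀ j : ℕ, j ≤ 2*N → ⌊X + ((j:ℝ) - N)*lam⌋ = ⌊X + ((0:ℝ) - N)*lam⌋ := by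
      intro j
      induction j with
      | zero => intro _; simp
      | succ j ih =>
        intro hj
        rw [← ih (by omega)]
        apply le_antisymm
        · rw [hall j (Finset.mem_range.2 (by omega))]
          apply Int.floor_mono; push_cast; linarith
        · apply Int.floor_mono; push_cast; linarith
    have hend : ⌊X' + (N:ℝ)*lam⌋ = ⌊X + ((0:ℝ) - N)*lam⌋ := by
      have h1 := hall (2*N) (Finset.mem_range.2 (by omega))
      have h2 := hind (2*N) le_rfl
      rw [h1] at h2
      rw [← h2]; congr 1; push_cast; ring
    have hgen : ∀ t, X + ((0:ℝ) - N)*lam ≤ t → t ≤ X' + N*lam →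
        ⌊t⌋ = ⌊X + ((0:ℝ) - N)*lam⌋ := by
      intro t h1 h2
      exact le_antisymm (hend ▸ Int.floor_mono h2) (Int.floor_mono h1)
    constructor
    · intro t ht
      rw [abs_le] at ht
      apply hgen <;> linarith
    · intro t ht
      rw [abs_le] at ht
      apply hgen <;> linarith
  · left
    push Not at hall
    obtain ⟨j, hj, hne⟩ := hall
    have := Finset.sum_lt_sum hterm ⟨j, hj, lt_of_le_of_ne (hterm j hj) hne⟩
    exact this

/-! ### One step of the fourth iterate -/

lemma Fe_apply (lam : ℝ) (p : ℤ × ℤ) : Fe lam p = (⌊lam * p.1⌋ - p.2, p.1) := rfl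

lemma Fe_four (lam : ℝ) (p : ℤ × ℤ) : (Fe lam ^ 4) p = Fe lam (Fe lam (Fe lam (Fe lam p))) := rfl

/-- Energy of a lattice point. -/
noncomputable def En (lam : ℝ) (p : ℤ × ℤ) : ℝ := ham (pt lam p)

lemma En_eq (lam : ℝ) (p : ℤ × ℤ) : En lam p = Pfun (lam * p.1) + Pfun (lam * p.2) := rfl

/-- Signed (lattice) distance from the diagonal. -/
def Dg (p : ℤ × ℤ) : ℤ := p.1 - p.2

/-- The bounded potential absorbing the energy errors. -/
noncomputable def Vp (lam : ℝ) (R : ℕ) (p : ℤ × ℤ) : ℤ :=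
  (2*((2*(2*R+2)+1)*(R+3))+1) * Phi lam (2*R+2) (lam * p.1)
    + (if 0 ≤ p.1 then -1 else 1) * Phi lam (2*R+2) (lam * p.2)

def Mc (R : ℕ) : ℤ := (2*(2*R+2)+1)*(R+3)

lemma Vp_abs {lam : ℝ} {R : ℕ} (h0 : 0 < lam) (hN : lam * (2*R+2) ≤ 1) (p : ℤ × ℤ)
    (hX : |lam * p.1| ≤ R+1) (hY : |lam * p.2| ≤ R+1) :
    |Vp lam R p| ≤ (2*Mc R + 1)*Mc R + Mc R := by
  have h1 := Phi_abs (N := 2*R+2) h0 (by push_cast; exact hN) hX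
  have h2 := Phi_abs (N := 2*R+2) h0 (by push_cast; exact hN) hY
  have e : ((2*((2*R+2 : ℕ):ℤ)+1)*(R+3)) = Mc R := by simp [Mc]
  rw [e] at h1 h2
  have hM : 0 ≤ Mc R := by unfold Mc; positivity
  have e2 : Vp lam R p = (2*Mc R+1) * Phi lam (2*R+2) (lam * p.1)
    + (if 0 ≤ p.1 then -1 else 1) * Phi lam (2*R+2) (lam * p.2) := rfl
  rw [e2]
  refine (abs_add_le _ _).trans (add_le_add ?_ ?_)
  · rw [abs_mul, abs_of_nonneg (by linarith : (0:ℤ) ≤ 2*Mc R+1)]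
    exact mul_le_mul_of_nonneg_left h1 (by linarith)
  · split_ifs <;> simpa using h2

/-- Basic facts on the four floors entering the fourth iterate. -/
lemma step_basic {R : ℕ} {lam c : ℝ} (h0 : 0 < lam) (hl : lam * (2*R+2) ≤ 1)
    (hlc : lam * (2*R+2) ≤ c) (p : ℤ × ℤ) (hX : |lam * p.1| ≤ R) (hY : lam * p.2 ≤ R)
    (hYc : c ≤ lam * p.2) :
    ∃ a0 a1 a2 a3 : ℤ, a0 = ⌊lam * p.1⌋ ∧ a1 = ⌊lam * a0 - lam * p.2⌋ ∧
      a2 = ⌊lam * a1 - lam * p.1⌋ ∧ a3 = ⌊lam * (a2 - a0) + lam * p.2⌋ ∧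
      (Fe lam ^ 4) p = (p.1 + (a3 - a1), p.2 + (a2 - a0)) ∧
      |a0| ≤ R ∧ a1 ≤ -1 ∧ -(R+1) ≤ a1 ∧ |a2| ≤ R + 1 ∧ 0 ≤ a3 ∧ a3 ≤ R + 1 ∧
      |a2 - a0| ≤ 2*R+1 ∧ (0 ≤ p.1 → 0 ≤ a0 ∧ a2 ≤ -1) := by
  have hR : (0:ℝ) ≤ R := by positivity
  obtain ⟨a0, ha0⟩ : ∃ a, a = ⌊lam * (p.1:ℝ)⌋ := ⟨_, rfl⟩
  obtain ⟨a1, ha1⟩ : ∃ a, a = ⌊lam * (a0:ℝ) - lam * p.2⌋ := ⟨_, rfl⟩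
  obtain ⟨a2, ha2⟩ : ∃ a, a = ⌊lam * (a1:ℝ) - lam * p.1⌋ := ⟨_, rfl⟩
  obtain ⟨a3, ha3⟩ : ∃ a, a = ⌊lam * ((a2:ℝ) - a0) + lam * p.2⌋ := ⟨_, rfl⟩
  have hX' := abs_le.1 hX
  have hlR : lam * R ≤ 1 := by nlinarith
  have b0 : |a0| ≤ R := by
    rw [abs_le, ha0]
    constructor
    · apply Int.le_floor.2; push_cast; linarith
    · have : (⌊lam * (p.1:ℝ)⌋ : ℝ) ≤ R := (Int.floor_le _).trans hX'.2
      exact_mod_cast this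
  have b0' : |(a0:ℝ)| ≤ R := by exact_mod_cast b0
  rw [abs_le] at b0'
  have hla0 : lam * a0 ≤ lam * R := mul_le_mul_of_nonneg_left b0'.2 h0.le
  have hla0' : -(lam * R) ≤ lam * a0 := by nlinarith [b0'.1]
  have b1 : a1 ≤ -1 := by
    rw [ha1]
    have : ⌊lam * (a0:ℝ) - lam * p.2⌋ < 0 := by
      apply Int.floor_lt.2; push_cast; nlinarith
    omega
  have b1' : -(R+1) ≤ a1 := by
    rw [ha1]; apply Int.le_floor.2; push_cast; linarith
  have b1r : -((R:ℝ)+1) ≤ a1 := by exact_mod_cast b1'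
  have b1r' : (a1:ℝ) ≤ -1 := by exact_mod_cast b1
  have b2 : |a2| ≤ R+1 := by
    rw [abs_le, ha2]
    constructor
    · apply Int.le_floor.2; push_cast; nlinarith
    · have : (⌊lam * (a1:ℝ) - lam * p.1⌋ : ℝ) ≤ R + 1 :=
        (Int.floor_le _).trans (by nlinarith)
      exact_mod_cast this
  have b20 : |a2 - a0| ≤ 2*R+1 := by
    rw [abs_le] at *; omega
  have b20r : |(a2:ℝ) - a0| ≤ 2*R+1 := by exact_mod_cast b20
  rw [abs_le] at b20r
  have b3 : 0 ≤ a3 := by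
    rw [ha3]; apply Int.floor_nonneg.2; nlinarith
  have b3' : a3 ≤ R + 1 := by
    rw [ha3]
    have : (⌊lam * ((a2:ℝ)-a0) + lam * p.2⌋ : ℝ) ≤ R + 1 :=
        (Int.floor_le _).trans (by nlinarith)
    exact_mod_cast this
  refine ⟨a0, a1, a2, a3, ha0, ha1, ha2, ha3, ?_, b0, b1, b1', b2, b3, b3', b20, ?_⟩
  · rw [Fe_four]
    have e1 : Fe lam p = (a0 - p.2, p.1) := by rw [Fe_apply, ha0]
    have e2 : Fe lam (a0 - p.2, p.1) = (a1 - p.1, a0 - p.2) := by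
      rw [Fe_apply, ha1]; push_cast; rw [mul_sub]
    have e3 : Fe lam (a1 - p.1, a0 - p.2) = (a2 - (a0 - p.2), a1 - p.1) := by
      rw [Fe_apply, ha2]; push_cast; rw [mul_sub]
    have e4 : Fe lam (a2 - (a0 - p.2), a1 - p.1) = (a3 - (a1 - p.1), a2 - (a0 - p.2)) := by
      rw [Fe_apply, ha3]; push_cast
      congr 3; ring
    rw [e1, e2, e3, e4]
    ext <;> simp <;> ring
  · intro hp
    have hp' : (0:ℝ) ≤ p.1 := by exact_mod_cast hp
    constructor
    · rw [ha0]; apply Int.floor_nonneg.2; positivity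
    · rw [ha2]
      have : ⌊lam * (a1:ℝ) - lam * p.1⌋ < 0 := by
        apply Int.floor_lt.2; push_cast; nlinarith
      omega

/-- Monotonicity and step bounds. -/
lemma step_bounds {R : ℕ} {lam c : ℝ} (h0 : 0 < lam) (hl : lam * (2*R+2) ≤ 1)
    (hlc : lam * (2*R+2) ≤ c) (p : ℤ × ℤ) (hX : |lam * p.1| ≤ R) (hY : lam * p.2 ≤ R)
    (hYc : c ≤ lam * p.2) :
    p.1 + 1 ≤ ((Fe lam ^ 4) p).1 ∧ ((Fe lam ^ 4) p).1 ≤ p.1 + (2*R+2) ∧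
    |((Fe lam ^ 4) p).2 - p.2| ≤ 2*R+2 ∧ (0 ≤ p.1 → Dg p < Dg ((Fe lam ^ 4) p)) := by
  obtain ⟨a0, a1, a2, a3, -, -, -, -, hF, b0, b1, b1', b2, b3, b3', b20, bp⟩ :=
    step_basic h0 hl hlc p hX hY hYc
  rw [hF]
  rw [abs_le] at b20
  refine ⟨by simp; omega, by simp; omega, ?_, ?_⟩
  · simp only [abs_le]; constructor <;> omega
  · intro hp
    have := bp hp
    simp only [Dg]; omega

def Bc (R : ℕ) : ℝ := 2*(2*R+3)*(2*R+2)

set_option maxHeartbeats 1600000 in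
/-- Energy estimate for one step. -/
lemma step_energy {R : ℕ} {lam c : ℝ} (h0 : 0 < lam) (hl : lam * (2*R+2) ≤ 1)
    (hlc : lam * (2*R+2) ≤ c) (p : ℤ × ℤ) (hX : |lam * p.1| ≤ R) (hY : lam * p.2 ≤ R)
    (hYc : c ≤ lam * p.2) :
    |En lam ((Fe lam ^ 4) p) - En lam p| ≤
      lam * Bc R * ((Vp lam R ((Fe lam ^ 4) p) : ℝ) - Vp lam R p) := by
  obtain ⟨c1, c2, c3, -⟩ := step_bounds h0 hl hlc p hX hY hYc
  obtain ⟨a0, a1, a2, a3, ha0, ha1, ha2, ha3, hF, b0, b1, b1', b2, b3, b3', b20, bp⟩ :=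
    step_basic h0 hl hlc p hX hY hYc
  set p' := (Fe lam ^ 4) p with hp'
  have c1r : (p.1:ℝ) + 1 ≤ p'.1 := by exact_mod_cast c1
  have c2r : (p'.1:ℝ) ≤ p.1 + (2*R+2) := by exact_mod_cast c2
  have c3r : |(p'.2:ℝ) - p.2| ≤ 2*R+2 := by exact_mod_cast c3
  have hR : (0:ℝ) ≤ R := by positivity
  have hB : 0 ≤ Bc R := by unfold Bc; positivity
  have hc : 0 ≤ c := le_trans (by positivity) hlc
  have hY' : |lam * (p.2:ℝ)| ≤ R := by rw [abs_le]; constructor <;> linarith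
  -- crude bounds
  have dX : |lam * (p'.1:ℝ) - lam * p.1| ≤ lam * (2*R+2) := by
    rw [← mul_sub, abs_mul, abs_of_pos h0]
    apply mul_le_mul_of_nonneg_left _ h0.le
    rw [abs_le]; constructor <;> linarith
  have dY : |lam * (p'.2:ℝ) - lam * p.2| ≤ lam * (2*R+2) := by
    rw [← mul_sub, abs_mul, abs_of_pos h0]
    exact mul_le_mul_of_nonneg_left c3r h0.le
  have hX1 : |lam * (p.1:ℝ)| ≤ R + 1 := by linarith
  have hY1 : |lam * (p.2:ℝ)| ≤ R + 1 := by linarith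
  have hX1' : |lam * (p'.1:ℝ)| ≤ R + 1 := by
    rw [abs_le] at *; constructor <;> linarith
  have hY1' : |lam * (p'.2:ℝ)| ≤ R + 1 := by
    rw [abs_le] at *; constructor <;> linarith
  have crude : |En lam p' - En lam p| ≤ lam * Bc R := by
    rw [En_eq, En_eq]
    have l1 := Pfun_lip hX1' hX1
    have l2 := Pfun_lip hY1' hY1
    have l1' := l1.trans (mul_le_mul_of_nonneg_left dX (by positivity))
    have l2' := l2.trans (mul_le_mul_of_nonneg_left dY (by positivity))
    have : lam * Bc R = (2*R+3)*(lam*(2*R+2)) + (2*R+3)*(lam*(2*R+2)) := by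
      unfold Bc; ring
    rw [this]
    rw [abs_le] at *
    constructor <;> linarith
  -- reduction to an integer inequality
  have of_one : Vp lam R p + 1 ≤ Vp lam R p' → |En lam p' - En lam p| ≤
      lam * Bc R * ((Vp lam R p' : ℝ) - Vp lam R p) := by
    intro hv
    have hv' : (Vp lam R p : ℝ) + 1 ≤ Vp lam R p' := by exact_mod_cast hv
    have : lam * Bc R * 1 ≤ lam * Bc R * ((Vp lam R p' : ℝ) - Vp lam R p) :=
      mul_le_mul_of_nonneg_left (by linarith) (by positivity)
    linarith
  have eV : ∀ q, Vp lam R q = (2*Mc R+1) * Phi lam (2*R+2) (lam * q.1)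
    + (if 0 ≤ q.1 then -1 else 1) * Phi lam (2*R+2) (lam * q.2) := fun _ => rfl
  have hM : 0 ≤ Mc R := by unfold Mc; positivity
  have f1 := Phi_abs (N := 2*R+2) h0 (by push_cast; exact hl) hY1
  have f2 := Phi_abs (N := 2*R+2) h0 (by push_cast; exact hl) hY1'
  have e : ((2*((2*R+2 : ℕ):ℤ)+1)*(R+3)) = Mc R := by simp [Mc]
  rw [e, abs_le] at f1 f2
  rcases Phi_dichotomy (N := 2*R+2) (X := lam * p.1) (X' := lam * p'.1) h0 (by nlinarith)
    with hx | ⟨hx, a, hxa, hxa'⟩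
  · -- X-bad
    apply of_one
    rw [eV, eV]
    split_ifs <;> nlinarith
  · push_cast at hxa hxa'
    have ea0 : a0 = a := by rw [ha0]; exact hxa _ (by simp; positivity)
    have efl' : ⌊lam * (p'.1:ℝ)⌋ = a := hxa' _ (by simp; positivity)
    have efl : ⌊lam * (p.1:ℝ)⌋ = a := hxa _ (by simp; positivity)
    have b1r : -((R:ℝ)+1) ≤ a1 := by exact_mod_cast b1'
    have b1r' : (a1:ℝ) ≤ -1 := by exact_mod_cast b1
    have ea2 : a2 = -a-1 := by
      have g1 : ⌊lam * (p.1:ℝ) - lam * a1⌋ = a := hxa _ (by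
        rw [abs_le]; constructor <;> nlinarith)
      have g2 : ⌊lam * (p.1:ℝ) - lam * a1 - lam⌋ = a := hxa _ (by
        rw [abs_le]; constructor <;> nlinarith)
      rw [Int.floor_eq_iff] at g1 g2
      rw [ha2, Int.floor_eq_iff]
      push_cast
      constructor <;> linarith
    have hsgn : (0 ≤ p.1 ↔ 0 ≤ a) := by
      rw [← efl, Int.floor_nonneg, mul_nonneg_iff_of_pos_left h0]; simp
    have hsgn' : (0 ≤ p'.1 ↔ 0 ≤ a) := by
      rw [← efl', Int.floor_nonneg, mul_nonneg_iff_of_pos_left h0]; simp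
    have hy : p'.2 = p.2 - (2*a+1) := by rw [hF]; simp; omega
    have hyr : (p'.2:ℝ) = p.2 - (2*a+1) := by exact_mod_cast hy
    -- the conclusion once Y is good
    have good : ∀ b : ℤ, (∀ t, |t - lam * (p.2:ℝ)| ≤ (2*R+2)*lam → ⌊t⌋ = b) →
        (∀ t, |t - lam * (p'.2:ℝ)| ≤ (2*R+2)*lam → ⌊t⌋ = b) → En lam p' - En lam p = 0 := by
      intro b hb hb'
      have eb : ⌊lam * (p.2:ℝ)⌋ = b := hb _ (by simp; positivity)
      have eb' : ⌊lam * (p'.2:ℝ)⌋ = b := hb' _ (by simp; positivity)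
      have b0r : |(a0:ℝ)| ≤ R := by exact_mod_cast b0
      have b20r : |(a2:ℝ) - a0| ≤ 2*R+1 := by exact_mod_cast b20
      rw [abs_le] at b0r b20r
      have ea3 : a3 = b := by
        rw [ha3]; apply hb; rw [abs_le]; constructor <;> nlinarith
      have ea1 : a1 = -b-1 := by
        have g1 : ⌊lam * (p.2:ℝ) - lam * a0⌋ = b := hb _ (by
          rw [abs_le]; constructor <;> nlinarith)
        have g2 : ⌊lam * (p.2:ℝ) - lam * a0 - lam⌋ = b := hb _ (by
          rw [abs_le]; constructor <;> nlinarith)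
        rw [Int.floor_eq_iff] at g1 g2
        rw [ha1, Int.floor_eq_iff]
        push_cast
        constructor <;> linarith
      have hx1 : p'.1 = p.1 + (2*b+1) := by rw [hF]; simp; omega
      have hxr : (p'.1:ℝ) = p.1 + (2*b+1) := by exact_mod_cast hx1
      have q1 := Pfun_affine efl efl'
      have q2 := Pfun_affine eb eb'
      rw [En_eq, En_eq]
      rw [hxr] at q1 ⊢
      rw [hyr] at q2 ⊢
      linear_combination q1 + q2
    rcases le_or_gt 0 a with hapos | haneg
    · have s1 : 0 ≤ p.1 := hsgn.2 hapos
      have s2 : 0 ≤ p'.1 := hsgn'.2 hapos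
      have har : (0:ℝ) ≤ a := by exact_mod_cast hapos
      rcases Phi_dichotomy (N := 2*R+2) (X := lam * p'.2) (X' := lam * p.2) h0
        (by rw [hyr]; nlinarith) with hyy | ⟨hyy, b, hb, hb'⟩
      · apply of_one
        rw [eV, eV, if_pos s1, if_pos s2, hx]; linarith
      · push_cast at hb hb'
        rw [good b hb' hb, eV, eV, if_pos s1, if_pos s2, hx, hyy]; simp
    · have s1 : ¬ 0 ≤ p.1 := fun h => absurd (hsgn.1 h) (by omega)
      have s2 : ¬ 0 ≤ p'.1 := fun h => absurd (hsgn'.1 h) (by omega)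
      have har : (a:ℝ) ≤ -1 := by exact_mod_cast (by omega : a ≤ -1)
      rcases Phi_dichotomy (N := 2*R+2) (X := lam * p.2) (X' := lam * p'.2) h0
        (by rw [hyr]; nlinarith) with hyy | ⟨hyy, b, hb, hb'⟩
      · apply of_one
        rw [eV, eV, if_neg s1, if_neg s2, hx]; linarith
      · push_cast at hb hb'
        rw [good b hb hb', eV, eV, if_neg s1, if_neg s2, hx, hyy]; simp

/-! ### Running through the top sector -/

/-- Energy drift constant. -/
noncomputable def C1 (R : ℕ) : ℝ := Bc R * (2*(((2*Mc R + 1)*Mc R + Mc R : ℤ) : ℝ))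

noncomputable def Kc (R : ℕ) : ℝ := C1 R + 4*(2*R+3)^2

/-- Smallness assumptions on the parameter. -/
structure SmallPar (h : ℝ) (R : ℕ) (lam : ℝ) : Prop where
  hpos : 0 < h
  hR : h + 2 ≤ R
  lpos : 0 < lam
  l1 : lam * Kc R ≤ h / 100
  l2 : lam * Kc R ≤ 1 / 100

/-- Lower bound for the ordinate in the top sector. -/
noncomputable def cc (h : ℝ) (R : ℕ) : ℝ := h / (8*(2*R+3))

structure Good (h : ℝ) (R : ℕ) (lam : ℝ) (p : ℤ × ℤ) : Prop where
  hX : |lam * p.1| ≤ R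
  hY : lam * p.2 ≤ R
  hYc : cc h R ≤ lam * p.2

lemma Bc_nonneg (R : ℕ) : 0 ≤ Bc R := by unfold Bc; positivity

lemma Mc_nonneg (R : ℕ) : 0 ≤ Mc R := by unfold Mc; positivity

lemma C1_nonneg (R : ℕ) : 0 ≤ C1 R := by
  have := Mc_nonneg R
  have h2 : (0:ℝ) ≤ (((2*Mc R + 1)*Mc R + Mc R : ℤ) : ℝ) := by exact_mod_cast (by positivity)
  have := Bc_nonneg R
  unfold C1; positivity

namespace SmallPar

variable {h : ℝ} {R : ℕ} {lam : ℝ}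

lemma C1_le (S : SmallPar h R lam) : lam * C1 R ≤ lam * Kc R := by
  have := S.lpos
  unfold Kc
  apply mul_le_mul_of_nonneg_left _ this.le
  have : (0:ℝ) ≤ 4*(2*R+3)^2 := by positivity
  linarith

lemma sq_le (S : SmallPar h R lam) : lam * (4*(2*R+3)^2) ≤ lam * Kc R := by
  unfold Kc
  apply mul_le_mul_of_nonneg_left _ S.lpos.le
  linarith [C1_nonneg R]

lemma hl (S : SmallPar h R lam) : lam * (2*R+2) ≤ 1 := by
  have h1 := S.sq_le
  have h2 := S.l2
  have h3 := S.lpos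
  have hR : (0:ℝ) ≤ R := by positivity
  have : lam * (2*R+2) ≤ lam * (4*(2*R+3)^2) := by
    apply mul_le_mul_of_nonneg_left _ h3.le; nlinarith
  linarith

lemma cpos (S : SmallPar h R lam) : 0 < cc h R := by
  have := S.hpos
  unfold cc; positivity

lemma hlc4 (S : SmallPar h R lam) : 4 * (lam * (2*R+2)) ≤ cc h R := by
  have h1 := S.sq_le
  have h2 := S.l1
  have h3 := S.lpos
  have hh := S.hpos
  unfold cc
  rw [le_div_iff₀ (by positivity)]
  have hR : (0:ℝ) ≤ R := by positivity
  have : lam * (2*R+2) * (2*R+3) ≤ lam * ((2*R+3)^2) := by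
    rw [mul_assoc]
    apply mul_le_mul_of_nonneg_left _ h3.le; nlinarith
  nlinarith

lemma hlc (S : SmallPar h R lam) : lam * (2*R+2) ≤ cc h R := by
  have := S.hlc4
  have h3 := S.lpos
  have : 0 ≤ lam * (2*R+2) := by positivity
  linarith

/-- Lower bound on coordinate from lower bound on its energy. -/
lemma coord_ge (_S : SmallPar h R lam) {y : ℝ} (hy : 0 ≤ y) (hyR : y ≤ R) (hP : h/8 ≤ Pfun y) :
    cc h R ≤ y := by
  have := Pfun_lip (R := R) (x := y) (y := 0) (by rw [abs_of_nonneg hy]; linarith)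
    (by simp; positivity)
  rw [Pfun_zero, sub_zero, sub_zero, abs_of_nonneg hy] at this
  have h2 := (le_abs_self _).trans this
  unfold cc
  rw [div_le_iff₀ (by positivity)]
  linarith

lemma bound_of_En (S : SmallPar h R lam) {p : ℤ × ℤ} (hE : En lam p ≤ h + 1) :
    |lam * (p.1:ℝ)| ≤ R - 1 ∧ |lam * (p.2:ℝ)| ≤ R - 1 := by
  rw [En_eq] at hE
  have h1 := abs_le_Pfun (lam * p.1)
  have h2 := abs_le_Pfun (lam * p.2)
  have h3 := abs_nonneg (lam * (p.1:ℝ))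
  have h4 := abs_nonneg (lam * (p.2:ℝ))
  have := S.hR
  constructor <;> linarith

end SmallPar

lemma Fe_pow_succ4 (lam : ℝ) (k : ℕ) (p : ℤ × ℤ) :
    (Fe lam ^ (4*(k+1))) p = (Fe lam ^ 4) ((Fe lam ^ (4*k)) p) := by
  rw [← Equiv.Perm.mul_apply, ← pow_add]; congr 2; ring

lemma Vdiff {h : ℝ} {R : ℕ} {lam : ℝ} (S : SmallPar h R lam) (p q : ℤ × ℤ)
    (h1 : |lam * p.1| ≤ R+1) (h2 : |lam * p.2| ≤ R+1)
    (h3 : |lam * q.1| ≤ R+1) (h4 : |lam * q.2| ≤ R+1) :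
    lam * Bc R * ((Vp lam R q : ℝ) - Vp lam R p) ≤ lam * C1 R := by
  have v1 := abs_le.1 (Vp_abs S.lpos S.hl p h1 h2)
  have v2 := abs_le.1 (Vp_abs S.lpos S.hl q h3 h4)
  have : Vp lam R q - Vp lam R p ≤ 2 * ((2*Mc R + 1)*Mc R + Mc R) := by linarith [v1.1, v2.2]
  have h' : (Vp lam R q : ℝ) - Vp lam R p ≤ 2 * (((2*Mc R + 1)*Mc R + Mc R : ℤ) : ℝ) := by
    exact_mod_cast this
  unfold C1
  rw [mul_assoc]
  exact mul_le_mul_of_nonneg_left (mul_le_mul_of_nonneg_left h' (Bc_nonneg R)) S.lpos.le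

/-- Admissible starting points in the top sector. -/
structure Start (h lam : ℝ) (p : ℤ × ℤ) : Prop where
  e1 : |En lam p - h| ≤ h / 8
  e2 : |En lam p - h| ≤ 1 / 2
  ypos : 0 < p.2
  py : h / 4 ≤ Pfun (lam * p.2)
  dg : Dg p < 0

lemma Good.next {h : ℝ} {R : ℕ} {lam : ℝ} (S : SmallPar h R lam) {p : ℤ × ℤ} (g : Good h R lam p) :
    |lam * (((Fe lam ^ 4) p).1 : ℝ)| ≤ R + 1 ∧ |lam * (((Fe lam ^ 4) p).2 : ℝ)| ≤ R + 1 ∧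
    0 < ((Fe lam ^ 4) p).2 := by
  obtain ⟨c1, c2, c3, -⟩ := step_bounds S.lpos S.hl S.hlc p g.hX g.hY g.hYc
  set p' := (Fe lam ^ 4) p with hp'
  have c1r : (p.1:ℝ) + 1 ≤ p'.1 := by exact_mod_cast c1
  have c2r : (p'.1:ℝ) ≤ p.1 + (2*R+2) := by exact_mod_cast c2
  have c3r : |(p'.2:ℝ) - p.2| ≤ 2*R+2 := by exact_mod_cast c3
  have l0 := S.lpos
  have l1 := S.hl
  have l2 := S.hlc4
  have cp := S.cpos
  have hX := abs_le.1 g.hX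
  have hY := g.hY
  have hYc := g.hYc
  rw [abs_le] at c3r
  have m1 : lam * ((p.1:ℝ)+1) ≤ lam * p'.1 := mul_le_mul_of_nonneg_left c1r l0.le
  have m2 : lam * (p'.1:ℝ) ≤ lam * (p.1 + (2*R+2)) := mul_le_mul_of_nonneg_left c2r l0.le
  have m3 : lam * (p'.2 - p.2:ℝ) ≤ lam * (2*R+2) := mul_le_mul_of_nonneg_left c3r.2 l0.le
  have m4 : lam * (-(2*R+2)) ≤ lam * (p'.2 - p.2:ℝ) := mul_le_mul_of_nonneg_left c3r.1 l0.le
  have hypos : 0 < lam * (p'.2:ℝ) := by nlinarith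
  refine ⟨?_, ?_, ?_⟩
  · rw [abs_le]; constructor <;> nlinarith
  · rw [abs_le]; constructor <;> nlinarith
  · have := (mul_pos_iff_of_pos_left l0).1 hypos
    exact_mod_cast this

lemma good_of {h : ℝ} {R : ℕ} {lam : ℝ} (S : SmallPar h R lam) {p0 p : ℤ × ℤ} (st : Start h lam p0)
    (hy : 0 < p.2) (hx : p0.1 ≤ p.1) (hd : Dg p < 0)
    (hE : |En lam p - En lam p0| ≤ lam * C1 R) : Good h R lam p := by
  have l0 := S.lpos
  have e1 := abs_le.1 st.e1
  have e2 := abs_le.1 st.e2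
  have k1 := S.C1_le
  have k2 := S.l1
  have k3 := S.l2
  have hh := S.hpos
  rw [abs_le] at hE
  have hb := S.bound_of_En (p := p) (by linarith)
  have hb1 := abs_le.1 hb.1
  have hb2 := abs_le.1 hb.2
  have hyr : (0:ℝ) < lam * p.2 := mul_pos l0 (by exact_mod_cast hy)
  refine ⟨by linarith [hb.1], by linarith, ?_⟩
  apply S.coord_ge hyr.le (by linarith)
  have hEp : En lam p = Pfun (lam * p.1) + Pfun (lam * p.2) := rfl
  have hEp0 : En lam p0 = Pfun (lam * p0.1) + Pfun (lam * p0.2) := rfl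
  have py := st.py
  rcases le_or_gt 0 p.1 with hp | hp
  · have hp' : (0:ℝ) ≤ lam * p.1 := mul_nonneg l0.le (by exact_mod_cast hp)
    have hlt : lam * (p.1:ℝ) ≤ lam * p.2 := by
      apply mul_le_mul_of_nonneg_left _ l0.le
      unfold Dg at hd
      exact_mod_cast (by omega : p.1 ≤ p.2)
    have := Pfun_mono_sub hp' hlt
    linarith
  · have hp' : (0:ℝ) ≤ -(lam * p.1) := by
      have : (p.1:ℝ) ≤ 0 := by exact_mod_cast hp.le
      nlinarith
    have hlt : -(lam * (p.1:ℝ)) ≤ -(lam * p0.1) := by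
      have : (p0.1:ℝ) ≤ p.1 := by exact_mod_cast hx
      nlinarith
    have := Pfun_mono_sub hp' hlt
    rw [Pfun_neg, Pfun_neg] at this
    linarith

/-- Result of running through the top sector. -/
lemma run {h : ℝ} {R : ℕ} {lam : ℝ} (S : SmallPar h R lam) {p : ℤ × ℤ} (st : Start h lam p) :
    ∃ K : ℕ, 0 ≤ Dg ((Fe lam ^ (4*(K+1))) p) ∧
      (∀ k ≤ K, Good h R lam ((Fe lam ^ (4*k)) p) ∧ Dg ((Fe lam ^ (4*k)) p) < 0) ∧
      (∀ k ≤ K+1, |En lam ((Fe lam ^ (4*k)) p) - En lam p| ≤ lam * C1 R) := by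
  have l0 := S.lpos
  have hCn := C1_nonneg R
  have good0 : Good h R lam p := good_of S st st.ypos le_rfl st.dg (by simp; positivity)
  have hY0 : |lam * (p.2:ℝ)| ≤ R + 1 := by
    have := good0.hY
    have := good0.hYc
    have := S.cpos
    rw [abs_le]; constructor <;> linarith
  have hX0 : |lam * (p.1:ℝ)| ≤ R + 1 := by linarith [good0.hX]
  -- one-step propagation
  have prop : ∀ k : ℕ, Good h R lam ((Fe lam ^ (4*k)) p) →
      |En lam ((Fe lam ^ (4*k)) p) - En lam p| ≤
        lam * Bc R * ((Vp lam R ((Fe lam ^ (4*k)) p) : ℝ) - Vp lam R p) →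
      |En lam ((Fe lam ^ (4*(k+1))) p) - En lam p| ≤
        lam * Bc R * ((Vp lam R ((Fe lam ^ (4*(k+1))) p) : ℝ) - Vp lam R p) ∧
      |En lam ((Fe lam ^ (4*(k+1))) p) - En lam p| ≤ lam * C1 R := by
    intro k g hE
    have a : |En lam ((Fe lam ^ (4*(k+1))) p) - En lam p| ≤
        lam * Bc R * ((Vp lam R ((Fe lam ^ (4*(k+1))) p) : ℝ) - Vp lam R p) := by
      rw [Fe_pow_succ4]
      have se := step_energy S.lpos S.hl S.hlc _ g.hX g.hY g.hYc
      refine (abs_sub_le _ (En lam ((Fe lam ^ (4*k)) p)) _).trans ?_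
      linarith
    refine ⟨a, a.trans ?_⟩
    obtain ⟨n1, n2, -⟩ := g.next S
    rw [← Fe_pow_succ4] at n1 n2
    exact Vdiff S p _ hX0 hY0 n1 n2
  have claim : ∀ k : ℕ, (∀ i ≤ k, Dg ((Fe lam ^ (4*i)) p) < 0) →
      Good h R lam ((Fe lam ^ (4*k)) p) ∧ p.1 + k ≤ ((Fe lam ^ (4*k)) p).1 ∧
      |En lam ((Fe lam ^ (4*k)) p) - En lam p| ≤
        lam * Bc R * ((Vp lam R ((Fe lam ^ (4*k)) p) : ℝ) - Vp lam R p) := by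
    intro k
    induction k with
    | zero => intro _; simpa using good0
    | succ k ih =>
      intro hd
      obtain ⟨g, hx, hE⟩ := ih (fun i hi => hd i (by omega))
      obtain ⟨q1, q2⟩ := prop k g hE
      obtain ⟨c1, c2, c3, -⟩ := step_bounds S.lpos S.hl S.hlc _ g.hX g.hY g.hYc
      obtain ⟨-, -, n3⟩ := g.next S
      rw [← Fe_pow_succ4] at c1 n3
      refine ⟨good_of S st n3 (by omega) (hd (k+1) le_rfl) q2, ?_, q1⟩
      rw [Nat.cast_succ]; omega
  have hex : ∃ k : ℕ, 0 ≤ Dg ((Fe lam ^ (4*k)) p) := by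
    by_contra hcon
    push Not at hcon
    obtain ⟨n, hn⟩ := exists_nat_gt (2 * (R:ℝ) / lam)
    obtain ⟨g, hx, -⟩ := claim n (fun i _ => hcon i)
    have hx' : (p.1:ℝ) + n ≤ ((Fe lam ^ (4*n)) p).1 := by exact_mod_cast hx
    rw [div_lt_iff₀ l0] at hn
    have g1 := abs_le.1 g.hX
    have g0 := abs_le.1 good0.hX
    nlinarith
  classical
  have hs := Nat.find_spec hex
  have hmin : ∀ i < Nat.find hex, Dg ((Fe lam ^ (4*i)) p) < 0 := fun i hi =>
    not_le.1 (Nat.find_min hex hi)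
  generalize Nat.find hex = m at hs hmin
  cases m with
  | zero => exact absurd st.dg (by simpa using hs)
  | succ K =>
    refine ⟨K, hs, ?_, ?_⟩
    · intro k hk
      exact ⟨(claim k (fun i hi => hmin i (by omega))).1, hmin k (by omega)⟩
    · intro k hk
      cases k with
      | zero => simp; positivity
      | succ k =>
        obtain ⟨g, hx, hE⟩ := claim k (fun i hi => hmin i (by omega))
        exact (prop k g hE).2

/-! ### Single iterates of the rotation -/

lemma SmallPar.c2_le {h : ℝ} {R : ℕ} {lam : ℝ} (S : SmallPar h R lam) :
    lam * (2*R+3)^2 ≤ h / 400 ∧ lam * (2*R+3)^2 ≤ 1 / 400 := by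
  have h1 := S.sq_le
  have h2 := S.l1
  have h3 := S.l2
  constructor <;> linarith

/-- One iterate is close to the rotation by a right angle. -/
lemma rot_basic {h : ℝ} {R : ℕ} {lam : ℝ} (S : SmallPar h R lam) {p : ℤ × ℤ}
    (hE : En lam p ≤ h + 1) :
    (Fe lam p).2 = p.1 ∧ |lam * ((Fe lam p).1 : ℝ) - -(lam * p.2)| ≤ lam * R ∧
    |Pfun (lam * ((Fe lam p).1 : ℝ)) - Pfun (lam * p.2)| ≤ lam * (2*R+3)^2 ∧
    |⌊lam * (p.1:ℝ)⌋| ≤ R := by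
  have l0 := S.lpos
  obtain ⟨b1, b2⟩ := S.bound_of_En hE
  have hR : (0:ℝ) ≤ R := by positivity
  have hlR : lam * R ≤ 1 := by nlinarith [S.hl]
  have fl : |⌊lam * (p.1:ℝ)⌋| ≤ R := by
    have h1 := Int.floor_le (lam * (p.1:ℝ))
    have h2 := Int.lt_floor_add_one (lam * (p.1:ℝ))
    have : |(⌊lam * (p.1:ℝ)⌋:ℝ)| ≤ R := by
      rw [abs_le] at *; constructor <;> linarith
    exact_mod_cast this
  have fl' : |(⌊lam * (p.1:ℝ)⌋:ℝ)| ≤ R := by exact_mod_cast fl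
  have key : |lam * ((Fe lam p).1 : ℝ) - -(lam * p.2)| ≤ lam * R := by
    have : lam * ((Fe lam p).1 : ℝ) - -(lam * p.2) = lam * ⌊lam * (p.1:ℝ)⌋ := by
      rw [Fe_apply]; push_cast; ring
    rw [this, abs_mul, abs_of_pos l0]
    exact mul_le_mul_of_nonneg_left fl' l0.le
  refine ⟨rfl, key, ?_, fl⟩
  rw [← Pfun_neg (lam * p.2)]
  refine (Pfun_lip (R := R) ?_ ?_).trans ?_
  · rw [abs_le] at *; constructor <;> linarith
  · rw [abs_neg]; linarith
  · refine (mul_le_mul_of_nonneg_left key (by positivity)).trans ?_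
    nlinarith [mul_nonneg l0.le hR]

lemma En_F {h : ℝ} {R : ℕ} {lam : ℝ} (S : SmallPar h R lam) {p : ℤ × ℤ}
    (hE : En lam p ≤ h + 1) : |En lam (Fe lam p) - En lam p| ≤ lam * (2*R+3)^2 := by
  obtain ⟨h1, -, h3, -⟩ := rot_basic S hE
  rw [En_eq, En_eq, h1]
  convert h3 using 2; ring

lemma Fe_pow_succ (lam : ℝ) (k : ℕ) (p : ℤ × ℤ) :
    (Fe lam ^ (k+1)) p = Fe lam ((Fe lam ^ k) p) := by
  rw [pow_succ', Equiv.Perm.mul_apply]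

lemma Fe_pow_add (lam : ℝ) (k l : ℕ) (p : ℤ × ℤ) :
    (Fe lam ^ (k+l)) p = (Fe lam ^ l) ((Fe lam ^ k) p) := by
  rw [add_comm, pow_add, Equiv.Perm.mul_apply]

lemma En_pow {h : ℝ} {R : ℕ} {lam : ℝ} (S : SmallPar h R lam) {p : ℤ × ℤ}
    (hE : En lam p ≤ h + 9/10) (r : ℕ) (hr : r ≤ 4) :
    |En lam ((Fe lam ^ r) p) - En lam p| ≤ r * (lam * (2*R+3)^2) := by
  have l0 := S.lpos
  have c2 := S.c2_le.2
  have c0 : 0 ≤ lam * (2*R+3)^2 := by positivity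
  induction r with
  | zero => simp
  | succ r ih =>
    have ih := ih (by omega)
    have hr' : (r:ℝ) ≤ 4 := by exact_mod_cast (by omega : r ≤ 4)
    have h1 : En lam ((Fe lam ^ r) p) ≤ h + 1 := by
      have := (abs_le.1 ih).2
      nlinarith
    have := En_F S h1
    rw [Fe_pow_succ]
    refine (abs_sub_le _ (En lam ((Fe lam ^ r) p)) _).trans ?_
    rw [Nat.cast_succ]
    linarith

/-- Every point of the right energy reaches the top sector in a few iterates. -/
lemma exists_start {h : ℝ} {R : ℕ} {lam ε : ℝ} (S : SmallPar h R lam) {p : ℤ × ℤ}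
    (hε1 : ε ≤ h/16) (hε2 : ε ≤ 1/4) (hE : |En lam p - h| ≤ ε) :
    ∃ j ≤ 4, Start h lam ((Fe lam ^ j) p) := by
  have l0 := S.lpos
  have hh := S.hpos
  obtain ⟨c2, c2'⟩ := S.c2_le
  have c0 : 0 ≤ lam * (2*R+3)^2 := by positivity
  have hlc4 := S.hlc4
  have cp := S.cpos
  have hR : (0:ℝ) ≤ R := by positivity
  have hE' := abs_le.1 hE
  have hlR : lam * R < cc h R := by nlinarith
  have en : ∀ r ≤ 4, |En lam ((Fe lam ^ r) p) - h| ≤ ε + 4 * (lam * (2*R+3)^2) := by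
    intro r hr
    have := En_pow S (p := p) (by linarith) r hr
    have hr' : (r:ℝ) ≤ 4 := by exact_mod_cast hr
    refine (abs_sub_le _ (En lam p) _).trans ?_
    nlinarith
  have en1 : ∀ r ≤ 4, En lam ((Fe lam ^ r) p) ≤ h + 1 := by
    intro r hr
    have := (abs_le.1 (en r hr)).2
    linarith
  -- first find a large positive ordinate
  have step1 : ∃ j ≤ 3, 0 < ((Fe lam ^ j) p).2 ∧ h/4 ≤ Pfun (lam * (((Fe lam ^ j) p).2:ℝ)) := by
    have hEp : En lam p = Pfun (lam * p.1) + Pfun (lam * p.2) := rfl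
    -- negative coordinate of large energy
    have negc : ∀ (q : ℤ × ℤ), En lam q ≤ h + 1 → h/3 ≤ Pfun (lam * q.2) → q.2 ≤ 0 →
        0 < (Fe lam q).1 ∧ h/4 ≤ Pfun (lam * ((Fe lam q).1:ℝ)) := by
      intro q hq hP hn
      obtain ⟨-, r2, r3, -⟩ := rot_basic S hq
      obtain ⟨-, b2⟩ := S.bound_of_En hq
      rw [abs_le] at r2 r3 b2
      have hn' : (0:ℝ) ≤ -(lam * q.2) := by
        have : (q.2:ℝ) ≤ 0 := by exact_mod_cast hn
        nlinarith
      have := S.coord_ge hn' (by linarith) (by rw [Pfun_neg]; linarith)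
      constructor
      · have : 0 < lam * ((Fe lam q).1:ℝ) := by linarith
        have := (mul_pos_iff_of_pos_left l0).1 this
        exact_mod_cast this
      · linarith
    have hpos : ∀ x : ℤ, h/3 ≤ Pfun (lam * x) → 0 ≤ x → 0 < x := by
      intro x hx h1
      rcases h1.lt_or_eq with h2 | h2
      · exact h2
      · rw [← h2] at hx; simp [Pfun_zero] at hx; linarith
    rcases le_total (Pfun (lam * p.1)) (Pfun (lam * p.2)) with hc | hc
    · have h3 : h/3 ≤ Pfun (lam * p.2) := by linarith
      rcases le_total 0 p.2 with hs | hs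
      · exact ⟨0, by omega, hpos _ h3 hs, by simp only [pow_zero, Equiv.Perm.coe_one, id]; linarith⟩
      · exact ⟨2, by omega, negc p (by linarith) h3 hs⟩
    · have h3 : h/3 ≤ Pfun (lam * p.1) := by linarith
      rcases le_total 0 p.1 with hs | hs
      · refine ⟨1, by omega, hpos _ h3 hs, ?_⟩
        rw [pow_one, (rot_basic S (by linarith : En lam p ≤ h + 1)).1]; linarith
      · exact ⟨3, by omega, negc (Fe lam p) (by simpa using en1 1 (by omega)) h3 hs⟩
  obtain ⟨j, hj, hy, hP⟩ := step1
  set q := (Fe lam ^ j) p with hq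
  have e1 : ε + 4 * (lam * (2*R+3)^2) ≤ h/8 := by linarith
  have e2 : ε + 4 * (lam * (2*R+3)^2) ≤ 1/2 := by linarith
  rcases lt_or_ge (Dg q) 0 with hd | hd
  · exact ⟨j, by omega, (en j (by omega)).trans e1, (en j (by omega)).trans e2, hy, hP, hd⟩
  · have hx : q.2 ≤ q.1 := by unfold Dg at hd; omega
    have hxr : (q.2:ℝ) ≤ q.1 := by exact_mod_cast hx
    have hyr : (0:ℝ) < lam * q.2 := mul_pos l0 (by exact_mod_cast hy)
    have hq1 := en1 j (by omega)
    rw [← hq] at hq1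
    obtain ⟨r1, r2, r3, r4⟩ := rot_basic S hq1
    obtain ⟨b1, b2⟩ := S.bound_of_En hq1
    rw [abs_le] at r2 b1 b2
    have hc := S.coord_ge hyr.le (by linarith) (by linarith)
    refine ⟨j+1, by omega, (en (j+1) (by omega)).trans e1, (en (j+1) (by omega)).trans e2,
      ?_, ?_, ?_⟩
    · rw [Fe_pow_succ, ← hq, r1]; omega
    · rw [Fe_pow_succ, ← hq, r1]
      have := Pfun_mono_sub hyr.le (mul_le_mul_of_nonneg_left hxr l0.le)
      have := mul_le_mul_of_nonneg_left hxr l0.le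
      linarith
    · rw [Fe_pow_succ, ← hq]
      have : lam * ((Fe lam q).1:ℝ) < 0 := by linarith
      have : ((Fe lam q).1:ℝ) < 0 := by
        by_contra hcon; push Not at hcon; nlinarith
      have : (Fe lam q).1 < 0 := by exact_mod_cast this
      unfold Dg; omega

/-- Control of all iterates following a start of the top sector. -/
lemma run_all {h : ℝ} {R : ℕ} {lam ε : ℝ} (S : SmallPar h R lam) {p : ℤ × ℤ}
    (hε2 : ε ≤ 1/2) (hE : |En lam p - h| ≤ ε) {K : ℕ}
    (hK : ∀ k ≤ K+1, |En lam ((Fe lam ^ (4*k)) p) - En lam p| ≤ lam * C1 R) :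
    ∀ i ≤ 4*K+4, |En lam ((Fe lam ^ i) p) - h| ≤ ε + lam * Kc R := by
  intro i hi
  have l0 := S.lpos
  have hE' := abs_le.1 hE
  have hk := hK (i/4) (by omega)
  have hk' := abs_le.1 hk
  have k1 := S.C1_le
  have k2 := S.l2
  have c0 : 0 ≤ lam * (2*R+3)^2 := by positivity
  have hp := En_pow S (p := (Fe lam ^ (4*(i/4))) p) (by linarith) (i%4) (by omega)
  rw [← Fe_pow_add, Nat.div_add_mod] at hp
  have hr' : ((i%4:ℕ):ℝ) ≤ 4 := by exact_mod_cast (by omega : i%4 ≤ 4)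
  have e : lam * Kc R = lam * C1 R + 4 * (lam * (2*R+3)^2) := by unfold Kc; ring
  have hp2 : |En lam ((Fe lam ^ i) p) - En lam ((Fe lam ^ (4*(i/4))) p)| ≤
      4 * (lam * (2*R+3)^2) := hp.trans (mul_le_mul_of_nonneg_right hr' c0)
  rw [abs_le] at *
  constructor <;> linarith

lemma Good.ge {h : ℝ} {R : ℕ} {lam : ℝ} (S : SmallPar h R lam) {p : ℤ × ℤ} (g : Good h R lam p) :
    4*(2*R+2) ≤ p.2 := by
  have h1 := S.hlc4
  have h2 := g.hYc
  have l0 := S.lpos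
  have : (4*(2*R+2) : ℝ) ≤ p.2 := by
    have : lam * (4*(2*R+2)) ≤ lam * p.2 := by linarith
    exact le_of_mul_le_mul_left this l0
  exact_mod_cast this

lemma forward {h : ℝ} {R : ℕ} {lam ε : ℝ} (S : SmallPar h R lam) {p : ℤ × ℤ}
    (hε1 : ε ≤ h/16) (hε2 : ε ≤ 1/4) (hE : |En lam p - h| ≤ ε) :
    ∃ n : ℕ, (∀ i ≤ n+4, |En lam ((Fe lam ^ i) p) - h| ≤ ε + lam * (2 * Kc R)) ∧
      4*(2*R+2) ≤ ((Fe lam ^ n) p).2 ∧ Dg ((Fe lam ^ n) p) < 0 ∧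
      0 ≤ Dg ((Fe lam ^ (n+4)) p) := by
  obtain ⟨j, hj, st⟩ := exists_start S hε1 hε2 hE
  obtain ⟨K, h1, h2, h3⟩ := run S st
  have l0 := S.lpos
  have k2 := S.l2
  have c0 : 0 ≤ lam * (2*R+3)^2 := by positivity
  have e : lam * Kc R = lam * C1 R + 4 * (lam * (2*R+3)^2) := by unfold Kc; ring
  have c1 : 0 ≤ lam * C1 R := mul_nonneg l0.le (C1_nonneg R)
  have hE' := abs_le.1 hE
  have pre : ∀ i ≤ 4, |En lam ((Fe lam ^ i) p) - h| ≤ ε + lam * Kc R := by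
    intro i hi
    have hp := En_pow S (p := p) (by linarith) i hi
    have hr' : (i:ℝ) ≤ 4 := by exact_mod_cast hi
    have hp2 := hp.trans (mul_le_mul_of_nonneg_right hr' c0)
    rw [abs_le] at *
    constructor <;> linarith
  refine ⟨j+4*K, ?_, ?_, ?_, ?_⟩
  · intro i hi
    rcases le_or_gt i j with hij | hij
    · refine (pre i (by omega)).trans ?_; linarith
    · obtain ⟨l, rfl⟩ := Nat.exists_eq_add_of_le hij.le
      rw [Fe_pow_add]
      refine (run_all S (by linarith) (pre j hj) h3 l (by omega)).trans ?_
      linarith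
  · rw [Fe_pow_add]; exact (h2 K le_rfl).1.ge S
  · rw [Fe_pow_add]; exact (h2 K le_rfl).2
  · rw [show j + 4*K + 4 = j + 4*(K+1) by ring, Fe_pow_add]; exact h1

/-! ### Reversibility and the return domain -/

lemma swap_pow (lam : ℝ) (n : ℕ) (p : ℤ × ℤ) :
    (Fe lam ^ (-(n:ℤ))) p = ((Fe lam ^ n) p.swap).swap := by
  rw [zpow_neg, zpow_natCast, Equiv.Perm.inv_eq_iff_eq]
  induction n generalizing p with
  | zero => simp
  | succ n ih =>
    rw [Fe_pow_succ lam n p.swap, pow_succ, Equiv.Perm.mul_apply]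
    have : Fe lam (Fe lam ((Fe lam ^ n) p.swap)).swap = ((Fe lam ^ n) p.swap).swap := by
      rw [Fe_apply, Fe_apply]; simp [Prod.swap]
    rw [this]; exact ih p

lemma Dg_swap (p : ℤ × ℤ) : Dg p.swap = - Dg p := by simp [Dg]

lemma En_swap (lam : ℝ) (p : ℤ × ℤ) : En lam p.swap = En lam p := by
  rw [En_eq, En_eq, add_comm]; simp

lemma swap_neg4 (lam : ℝ) (p : ℤ × ℤ) :
    (Fe lam ^ (-4 : ℤ)) p = ((Fe lam ^ 4) p.swap).swap := by
  have := swap_pow lam 4 p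
  simpa using this

lemma dline_eq {lam : ℝ} (h0 : 0 < lam) (p : ℤ × ℤ) :
    dline (pt lam p) = lam / Real.sqrt 2 * ((|Dg p| : ℤ) : ℝ) := by
  unfold dline pt Dg
  push_cast
  rw [← mul_sub, abs_mul, abs_of_pos h0]; ring

lemma mem_X {lam : ℝ} (h0 : 0 < lam) (p : ℤ × ℤ) : p ∈ Xset lam ↔
    0 ≤ p.1 ∧ 0 ≤ p.2 ∧ |Dg p| ≤ |Dg ((Fe lam ^ 4) p)| ∧
      |Dg p| < |Dg ((Fe lam ^ (-4 : ℤ)) p)| := by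
  unfold Xset
  rw [Set.mem_ofPred_eq, dline_eq h0, dline_eq h0, dline_eq h0,
    mul_le_mul_iff_right₀ (by positivity), mul_lt_mul_iff_right₀ (by positivity)]
  norm_cast

/-- Monotonicity, forward. -/
lemma mono_fwd {h : ℝ} {R : ℕ} {lam : ℝ} (S : SmallPar h R lam) {p : ℤ × ℤ}
    (hE : En lam p ≤ h + 1) (hy : 2*R+2 ≤ p.2) :
    p.1 + 1 ≤ ((Fe lam ^ 4) p).1 ∧ ((Fe lam ^ 4) p).1 ≤ p.1 + (2*R+2) ∧
    |((Fe lam ^ 4) p).2 - p.2| ≤ 2*R+2 ∧ (0 ≤ p.1 → Dg p < Dg ((Fe lam ^ 4) p)) := by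
  obtain ⟨b1, b2⟩ := S.bound_of_En hE
  have l0 := S.lpos
  have hyr : (2*R+2:ℝ) ≤ p.2 := by exact_mod_cast hy
  exact step_bounds S.lpos S.hl le_rfl p (by linarith) (by linarith [(abs_le.1 b2).2])
    (mul_le_mul_of_nonneg_left hyr l0.le)

/-- Monotonicity, backward. -/
lemma mono_bwd {h : ℝ} {R : ℕ} {lam : ℝ} (S : SmallPar h R lam) {p : ℤ × ℤ}
    (hE : En lam p ≤ h + 1) (hy : 2*R+2 ≤ p.1) :
    p.2 + 1 ≤ ((Fe lam ^ (-4:ℤ)) p).2 ∧ ((Fe lam ^ (-4:ℤ)) p).2 ≤ p.2 + (2*R+2) ∧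
    |((Fe lam ^ (-4:ℤ)) p).1 - p.1| ≤ 2*R+2 ∧ (0 ≤ p.2 → Dg ((Fe lam ^ (-4:ℤ)) p) < Dg p) := by
  obtain ⟨h1, h2, h3, h4⟩ := mono_fwd S (p := p.swap) (by rwa [En_swap]) hy
  rw [swap_neg4]
  refine ⟨h1, h2, h3, fun h => ?_⟩
  have := h4 h
  rw [Dg_swap] at *
  omega

lemma neg4_four (lam : ℝ) (p : ℤ × ℤ) : (Fe lam ^ (-4:ℤ)) ((Fe lam ^ 4) p) = p := by
  have : (Fe lam ^ (-4:ℤ)) = (Fe lam ^ 4)⁻¹ := by rw [zpow_neg]; rfl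
  rw [this, ← Equiv.Perm.mul_apply, inv_mul_cancel]; rfl

/-- A crossing of the diagonal produces a point of the return domain. -/
lemma cross_X {h : ℝ} {R : ℕ} {lam : ℝ} (S : SmallPar h R lam) {z : ℤ × ℤ}
    (hE : En lam z ≤ h + 1) (hE' : En lam ((Fe lam ^ 4) z) ≤ h + 1) (hy : 3*(2*R+2) ≤ z.2)
    (hd : Dg z ≤ 0) (hd' : 0 ≤ Dg ((Fe lam ^ 4) z)) :
    z ∈ Xset lam ∨ (Fe lam ^ 4) z ∈ Xset lam := by
  obtain ⟨a1, a2, a3, a4⟩ := mono_fwd S hE (by omega)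
  rw [abs_le] at a3
  have hDz : Dg z = z.1 - z.2 := rfl
  have hDz' : Dg ((Fe lam ^ 4) z) = ((Fe lam ^ 4) z).1 - ((Fe lam ^ 4) z).2 := rfl
  have hx : 2*R+2 ≤ z.1 := by omega
  have a4 := a4 (by omega)
  obtain ⟨-, -, -, b4⟩ := mono_bwd S hE hx
  have b4 := b4 (by omega)
  obtain ⟨-, -, -, c4⟩ := mono_fwd S hE' (by omega)
  have c4 := c4 (by omega)
  rcases le_or_gt |Dg z| |Dg ((Fe lam ^ 4) z)| with hc | hc
  · left
    rw [mem_X S.lpos]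
    refine ⟨by omega, by omega, hc, ?_⟩
    rw [abs_of_nonpos hd, abs_of_neg (by omega)]; omega
  · right
    rw [mem_X S.lpos, neg4_four]
    refine ⟨by omega, by omega, ?_, hc⟩
    rw [abs_of_nonneg hd', abs_of_pos (by omega)]; omega

/-- Going backwards one meets the return domain. -/
lemma backward {h : ℝ} {R : ℕ} {lam ε : ℝ} (S : SmallPar h R lam) {p : ℤ × ℤ}
    (hε1 : ε ≤ h/16) (hε2 : ε ≤ 1/4) (hE : |En lam p - h| ≤ ε) :
    ∃ n : ℕ, (Fe lam ^ (-(n:ℤ))) p ∈ Xset lam ∧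
      ∀ i ≤ n, |En lam ((Fe lam ^ (-(i:ℤ))) p) - h| ≤ ε + lam * (2 * Kc R) := by
  obtain ⟨n, h1, h2, h3, h4⟩ := forward S (p := p.swap) hε1 hε2 (by rwa [En_swap])
  have k2 := S.l2
  have en : ∀ i ≤ n+4, |En lam ((Fe lam ^ (-(i:ℤ))) p) - h| ≤ ε + lam * (2 * Kc R) := by
    intro i hi
    rw [swap_pow, En_swap]; exact h1 i hi
  have en1 : ∀ i ≤ n+4, En lam ((Fe lam ^ i) p.swap) ≤ h + 1 := by
    intro i hi
    have := (abs_le.1 (h1 i hi)).2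
    linarith
  have e4 : (Fe lam ^ 4) ((Fe lam ^ (-((n+4:ℕ):ℤ))) p) = (Fe lam ^ (-(n:ℤ))) p := by
    rw [← zpow_natCast, ← Equiv.Perm.mul_apply, ← zpow_add]
    congr 2; push_cast; ring
  obtain ⟨-, -, a3, -⟩ := mono_fwd S (en1 n (by omega)) (by omega)
  rw [← Fe_pow_add, abs_le] at a3
  have hD : Dg ((Fe lam ^ (n+4)) p.swap) =
    ((Fe lam ^ (n+4)) p.swap).1 - ((Fe lam ^ (n+4)) p.swap).2 := rfl
  have key := cross_X S (z := (Fe lam ^ (-((n+4:ℕ):ℤ))) p)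
    (by rw [swap_pow, En_swap]; exact en1 _ le_rfl)
    (by rw [e4, swap_pow, En_swap]; exact en1 _ (by omega))
    (by rw [swap_pow, Prod.snd_swap]; omega)
    (by rw [swap_pow, Dg_swap]; omega)
    (by rw [e4, swap_pow, Dg_swap]; omega)
  rw [e4] at key
  rcases key with hk | hk
  · exact ⟨n+4, hk, en⟩
  · exact ⟨n, hk, fun i hi => en i (by omega)⟩

/-- Points of the return domain are close to the diagonal. -/
lemma X_near {h : ℝ} {R : ℕ} {lam : ℝ} (S : SmallPar h R lam) {z : ℤ × ℤ}
    (hz : z ∈ Xset lam) (hE : |En lam z - h| ≤ h/2) (hE1 : En lam z ≤ h + 1) :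
    |Dg z| ≤ 2*(2*R+2) ∧ 2*(2*R+2) ≤ z.1 ∧ 2*(2*R+2) ≤ z.2 := by
  have hX := (mem_X S.lpos z).1 hz
  obtain ⟨x0, y0, d1, d2⟩ := hX
  have l0 := S.lpos
  have hh := S.hpos
  have hE' := abs_le.1 hE
  obtain ⟨b1, b2⟩ := S.bound_of_En hE1
  have hlc4 := S.hlc4
  have x0r : (0:ℝ) ≤ lam * z.1 := mul_nonneg l0.le (by exact_mod_cast x0)
  have y0r : (0:ℝ) ≤ lam * z.2 := mul_nonneg l0.le (by exact_mod_cast y0)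
  have hEn : En lam z = Pfun (lam * z.1) + Pfun (lam * z.2) := rfl
  have big : ∀ x : ℤ, (0:ℝ) ≤ lam * x → |lam * (x:ℝ)| ≤ R - 1 → h/8 ≤ Pfun (lam * x) →
      4*(2*R+2) ≤ x := by
    intro x h1 h2 h3
    have := S.coord_ge h1 (by linarith [(abs_le.1 h2).2]) h3
    have h4 : lam * (4*(2*R+2)) ≤ lam * x := by linarith
    have := le_of_mul_le_mul_left h4 l0
    exact_mod_cast this
  have hDz : Dg z = z.1 - z.2 := rfl
  rcases le_or_gt (Dg z) 0 with hd | hd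
  · have hle : lam * (z.1:ℝ) ≤ lam * z.2 := by
      apply mul_le_mul_of_nonneg_left _ l0.le
      exact_mod_cast (by omega : z.1 ≤ z.2)
    have := Pfun_mono_sub x0r hle
    have hb := big z.2 y0r b2 (by linarith)
    obtain ⟨a1, a2, a3, a4⟩ := mono_fwd S hE1 (by omega)
    have a4 := a4 x0
    have hDz' : Dg ((Fe lam ^ 4) z) = ((Fe lam ^ 4) z).1 - ((Fe lam ^ 4) z).2 := rfl
    rw [abs_le] at a3
    have hpos : 0 < Dg ((Fe lam ^ 4) z) := by
      by_contra hcon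
      rw [abs_of_nonpos hd, abs_of_nonpos (by omega)] at d1
      omega
    refine ⟨by rw [abs_le]; constructor <;> omega, by omega, by omega⟩
  · have hle : lam * (z.2:ℝ) ≤ lam * z.1 := by
      apply mul_le_mul_of_nonneg_left _ l0.le
      exact_mod_cast (by omega : z.2 ≤ z.1)
    have := Pfun_mono_sub y0r hle
    have hb := big z.1 x0r b1 (by linarith)
    obtain ⟨a1, a2, a3, a4⟩ := mono_bwd S hE1 (by omega)
    have a4 := a4 y0
    have hDz' : Dg ((Fe lam ^ (-4:ℤ)) z) =
      ((Fe lam ^ (-4:ℤ)) z).1 - ((Fe lam ^ (-4:ℤ)) z).2 := rfl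
    rw [abs_le] at a3
    have hneg : Dg ((Fe lam ^ (-4:ℤ)) z) < 0 := by
      by_contra hcon
      rw [abs_of_pos hd, abs_of_nonneg (by omega)] at d2
      omega
    refine ⟨by rw [abs_le]; constructor <;> omega, by omega, by omega⟩


/-! ### From one visit of the return domain to the next -/

lemma start_of_X {h : ℝ} {R : ℕ} {lam ε : ℝ} (S : SmallPar h R lam) {z : ℤ × ℤ}
    (hz : z ∈ Xset lam) (hε1 : ε ≤ h/16) (hε2 : ε ≤ 1/4) (hE : |En lam z - h| ≤ ε) :
    Start h lam (Fe lam z) := by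
  have l0 := S.lpos
  have hh := S.hpos
  obtain ⟨c2, c2'⟩ := S.c2_le
  have hE' := abs_le.1 hE
  have hE1 : En lam z ≤ h + 1 := by linarith
  obtain ⟨n1, n2, n3⟩ := X_near S hz (by linarith) hE1
  obtain ⟨r1, r2, r3, r4⟩ := rot_basic S hE1
  obtain ⟨b1, b2⟩ := S.bound_of_En hE1
  have eF := En_F S hE1
  have eF' := abs_le.1 eF
  have hR : (0:ℝ) ≤ R := by positivity
  refine ⟨?_, ?_, ?_, ?_, ?_⟩
  · rw [abs_le]; constructor <;> linarith
  · rw [abs_le]; constructor <;> linarith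
  · rw [r1]; omega
  · rw [r1]
    have hl := Pfun_lip (R := R) (x := lam * z.1) (y := lam * z.2) (by linarith) (by linarith)
    have hd : |lam * (z.1:ℝ) - lam * z.2| ≤ lam * (2*(2*R+2)) := by
      rw [← mul_sub, abs_mul, abs_of_pos l0]
      apply mul_le_mul_of_nonneg_left _ l0.le
      have : |z.1 - z.2| ≤ 2*(2*R+2) := n1
      exact_mod_cast this
    have h3 : (2*R+3) * |lam * (z.1:ℝ) - lam * z.2| ≤ 2 * (lam * (2*R+3)^2) := by
      calc (2*R+3) * |lam * (z.1:ℝ) - lam * z.2| ≤ (2*R+3) * (lam * (2*(2*R+2))) :=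
            mul_le_mul_of_nonneg_left hd (by positivity)
        _ ≤ 2 * (lam * (2*R+3)^2) := by nlinarith [mul_nonneg l0.le hR]
    have h4 := abs_le.1 (hl.trans h3)
    rw [En_eq] at hE'
    linarith
  · have : Dg (Fe lam z) = ⌊lam * (z.1:ℝ)⌋ - z.2 - z.1 := by rw [Fe_apply]; rfl
    rw [this]
    have := abs_le.1 r4
    omega

/-- No visit of the return domain strictly between. -/
lemma not_X {h : ℝ} {R : ℕ} {lam : ℝ} (S : SmallPar h R lam) {z : ℤ × ℤ}
    (hz : z ∈ Xset lam) {K : ℕ}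
    (hG : ∀ k ≤ K, Good h R lam ((Fe lam ^ (4*k+1)) z) ∧ Dg ((Fe lam ^ (4*k+1)) z) < 0)
    (hEn : ∀ i ≤ 4*K+5, En lam ((Fe lam ^ i) z) ≤ h + 1) :
    ∀ i, 1 ≤ i → i < 4*K+1 → (Fe lam ^ i) z ∉ Xset lam := by
  have l0 := S.lpos
  intro i hi1 hi2 hX
  have hX' := (mem_X l0 _).1 hX
  obtain ⟨x0, y0, d1, d2⟩ := hX'
  have hcase : ∃ k, k < K ∧ (i = 4*k+1 ∨ i = 4*k+1+1 ∨ i = 4*k+1+1+1 ∨ i = 4*(k+1)) :=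
    ⟨(i-1)/4, by omega, by omega⟩
  obtain ⟨k, hk, hc⟩ := hcase
  have gk := (hG k hk.le).1.ge S
  have ek := hEn (4*k+1) (by omega)
  obtain ⟨-, -, -, r4⟩ := rot_basic S ek
  have r4 := abs_le.1 r4
  rcases hc with hc | hc | hc | hc
  · subst hc
    obtain ⟨-, -, -, a4⟩ := mono_fwd S ek (by omega)
    have a4 := a4 x0
    rw [← Fe_pow_add] at d1 a4
    have n1 := (hG k hk.le).2
    have n2 := (hG (k+1) (by omega)).2
    rw [show 4*k+1+4 = 4*(k+1)+1 by ring] at d1 a4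
    rw [abs_of_neg n1, abs_of_neg n2] at d1
    omega
  · subst hc
    rw [Fe_pow_succ, Fe_apply] at x0
    simp only at x0
    omega
  · subst hc
    rw [Fe_pow_succ, Fe_apply, Fe_pow_succ, Fe_apply] at y0
    simp only at y0
    omega
  · subst hc
    have hv : ∀ m ≤ K, 4*(2*R+2) ≤ ((Fe lam ^ (4*m)) z).1 := by
      intro m hm
      have := (hG m hm).1.ge S
      rw [Fe_pow_succ, Fe_apply] at this
      exact this
    have bw : ∀ m < K, ((Fe lam ^ (4*(m+1))) z).2 + 1 ≤ ((Fe lam ^ (4*m)) z).2 ∧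
        (0 ≤ ((Fe lam ^ (4*(m+1))) z).2 →
          Dg ((Fe lam ^ (4*m)) z) < Dg ((Fe lam ^ (4*(m+1))) z)) := by
      intro m hm
      have hv' := hv (m+1) (by omega)
      obtain ⟨a1, -, -, a4⟩ := mono_bwd S (hEn (4*(m+1)) (by omega)) (by omega)
      rw [Fe_pow_succ4 lam m z, neg4_four] at a1 a4
      rw [Fe_pow_succ4 lam m z]
      exact ⟨a1, a4⟩
    have pos : ∀ j ≤ k+1, 0 ≤ ((Fe lam ^ (4*(k+1-j))) z).2 := by
      intro j
      induction j with
      | zero => intro _; exact y0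
      | succ j ih =>
        intro hj
        have := ih (by omega)
        have b := (bw (k+1-(j+1)) (by omega)).1
        rw [show k+1-(j+1)+1 = k+1-j by omega] at b
        omega
    have pos' : ∀ m ≤ k+1, 0 ≤ ((Fe lam ^ (4*m)) z).2 := by
      intro m hm
      have := pos (k+1-m) (by omega)
      rwa [show k+1-(k+1-m) = m by omega] at this
    have st : ∀ m ≤ k, Dg ((Fe lam ^ (4*m)) z) < Dg ((Fe lam ^ (4*(m+1))) z) :=
      fun m hm => (bw m (by omega)).2 (pos' (m+1) (by omega))
    have up : ∀ m ≤ k, Dg ((Fe lam ^ (4*1)) z) ≤ Dg ((Fe lam ^ (4*(m+1))) z) := by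
      intro m
      induction m with
      | zero => intro _; exact le_rfl
      | succ m ih => intro hm; exact (ih (by omega)).trans (st (m+1) hm).le
    have hz' := ((mem_X l0 _).1 hz).2.2.1
    have s0 := st 0 (by omega)
    rw [mul_zero, pow_zero, Equiv.Perm.one_apply, zero_add, mul_one] at s0
    have D1 : 0 < Dg ((Fe lam ^ 4) z) := by
      by_contra hcon
      rw [abs_of_nonpos (by omega : Dg z ≤ 0), abs_of_nonpos (by omega)] at hz'
      omega
    have sk := st k le_rfl
    rw [Fe_pow_succ4 lam k z, neg4_four, ← Fe_pow_succ4] at d2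
    have Dk : Dg ((Fe lam ^ (4*k)) z) < 0 := by
      by_contra hcon
      rw [abs_of_nonneg (by omega : 0 ≤ Dg ((Fe lam ^ (4*k)) z)), abs_of_nonneg (by omega)] at d2
      omega
    rcases k with _ | k
    · rw [mul_zero, pow_zero, Equiv.Perm.one_apply, zero_add, mul_one] at *
      rw [abs_of_neg Dk, abs_of_pos D1] at *
      omega
    · have := up k (by omega)
      rw [mul_one] at this
      omega

lemma consec {h : ℝ} {R : ℕ} {lam ε : ℝ} (S : SmallPar h R lam) {z : ℤ × ℤ}
    (hz : z ∈ Xset lam) (hε1 : ε ≤ h/16) (hε2 : ε ≤ 1/4) (hE : |En lam z - h| ≤ ε) :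
    ∃ K : ℕ, (∀ i ≤ 4*K+5, |En lam ((Fe lam ^ i) z) - h| ≤ ε + lam * (2*Kc R)) ∧
      ((Fe lam ^ (4*K+1)) z ∈ Xset lam ∨ (Fe lam ^ (4*K+5)) z ∈ Xset lam) ∧
      (∀ i, 1 ≤ i → i < 4*K+1 → (Fe lam ^ i) z ∉ Xset lam) ∧
      (∀ k ≤ K, Good h R lam ((Fe lam ^ (4*k+1)) z) ∧ Dg ((Fe lam ^ (4*k+1)) z) < 0) ∧
      0 ≤ Dg ((Fe lam ^ (4*K+5)) z) := by
  have l0 := S.lpos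
  have k2 := S.l2
  have k3 := S.sq_le
  have c0 : 0 ≤ lam * (2*R+3)^2 := by positivity
  have hE' := abs_le.1 hE
  have hE1 : En lam z ≤ h + 1 := by linarith
  have hs : ∀ k, (Fe lam ^ k) (Fe lam z) = (Fe lam ^ (k+1)) z := by
    intro k; rw [pow_succ, Equiv.Perm.mul_apply]
  obtain ⟨K, h1, h2, h3⟩ := run S (start_of_X S hz hε1 hε2 hE)
  have eF' := abs_le.1 (En_F S hE1)
  have ra := run_all S (p := Fe lam z) (ε := ε + lam * (2*R+3)^2) (by linarith [S.c2_le.2])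
    (by rw [abs_le]; constructor <;> linarith) h3
  have hEn : ∀ i ≤ 4*K+5, |En lam ((Fe lam ^ i) z) - h| ≤ ε + lam * (2*Kc R) := by
    intro i hi
    rcases i with _ | i
    · rw [pow_zero, Equiv.Perm.one_apply]; linarith
    · have := ra i (by omega)
      rw [hs] at this
      linarith
  have hEn1 : ∀ i ≤ 4*K+5, En lam ((Fe lam ^ i) z) ≤ h + 1 := by
    intro i hi
    have := (abs_le.1 (hEn i hi)).2
    linarith
  have hG : ∀ k ≤ K, Good h R lam ((Fe lam ^ (4*k+1)) z) ∧ Dg ((Fe lam ^ (4*k+1)) z) < 0 := by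
    intro k hk
    have := h2 k hk
    rwa [hs] at this
  rw [hs, show 4*(K+1)+1 = 4*K+5 by ring] at h1
  refine ⟨K, hEn, ?_, not_X S hz hG hEn1, hG, h1⟩
  have e5 : (Fe lam ^ (4*K+5)) z = (Fe lam ^ 4) ((Fe lam ^ (4*K+1)) z) := by
    rw [← Fe_pow_add]
  have g := (hG K le_rfl).1.ge S
  rw [e5]
  exact cross_X S (hEn1 _ (by omega)) (by rw [← e5]; exact hEn1 _ le_rfl) (by omega)
    (hG K le_rfl).2.le (by rw [← e5]; exact h1)

/-! ### Covering the level set -/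

lemma edge {R : ℕ} {a b s t h η κ : ℝ} (ha : 0 ≤ a) (haR : |a| ≤ R + 1) (hbR : |b| ≤ R + 1)
    (hab : |a - b| ≤ κ) (hη : 0 ≤ η) (hE : |Pfun a + Pfun b - h| ≤ η)
    (hst : Pfun s + Pfun t = h) (hs : 0 ≤ s) (ht : s ≤ t) :
    s ≤ a + (η + (2*R+3)*κ) := by
  have hκ : 0 ≤ κ := (abs_nonneg _).trans hab
  have hk : 0 ≤ (2*R+3)*κ := by positivity
  by_contra hcon
  push Not at hcon
  have h1 := Pfun_mono_sub ha (by linarith : a ≤ s)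
  have h2 := Pfun_mono_sub hs ht
  have h3 := (abs_le.1 (Pfun_lip haR hbR)).1
  have h4 : (2*R+3)*|a-b| ≤ (2*R+3)*κ := mul_le_mul_of_nonneg_left hab (by positivity)
  have h5 := (abs_le.1 hE).1
  linarith

lemma cover_top {h : ℝ} {R : ℕ} {lam η : ℝ} (S : SmallPar h R lam) {z : ℤ × ℤ} {K : ℕ}
    (hz : |Dg z| ≤ 2*(2*R+2)) (hz1 : 2*(2*R+2) ≤ z.1) (hz2 : 2*(2*R+2) ≤ z.2)
    (hη0 : 0 ≤ η) (hη : η ≤ 1/2)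
    (hEn : ∀ i ≤ 4*K+5, |En lam ((Fe lam ^ i) z) - h| ≤ η)
    (hG : ∀ k ≤ K, Good h R lam ((Fe lam ^ (4*k+1)) z) ∧ Dg ((Fe lam ^ (4*k+1)) z) < 0)
    (hD : 0 ≤ Dg ((Fe lam ^ (4*K+5)) z)) {s t : ℝ} (hst : Pfun s + Pfun t = h) (hle : |s| ≤ t)
    {δ2 δ3 : ℝ} (hδ2 : δ2 = η + (2*R+3)*(lam*(5*R+4)) + lam*(2*R+2))
    (hδ3 : δ3 = η + (2*R+3)*δ2) :
    ∃ k < K, |lam * (((Fe lam ^ (4*k+1)) z).1:ℝ) - s| ≤ δ3 ∧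
      |lam * (((Fe lam ^ (4*k+1)) z).2:ℝ) - t| ≤ δ3 := by
  have l0 := S.lpos
  have hR : (0:ℝ) ≤ R := by positivity
  have hE1 : ∀ i ≤ 4*K+5, En lam ((Fe lam ^ i) z) ≤ h + 1 := by
    intro i hi
    have := (abs_le.1 (hEn i hi)).2
    linarith
  have hb : ∀ i ≤ 4*K+5, |lam * (((Fe lam ^ i) z).1:ℝ)| ≤ R + 1 ∧
      |lam * (((Fe lam ^ i) z).2:ℝ)| ≤ R + 1 := by
    intro i hi
    obtain ⟨b1, b2⟩ := S.bound_of_En (hE1 i hi)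
    constructor <;> linarith
  -- first point
  have f0 : (Fe lam ^ (4*0+1)) z = (⌊lam * (z.1:ℝ)⌋ - z.2, z.1) := by
    rw [mul_zero, zero_add, pow_one, Fe_apply]
  obtain ⟨-, -, -, r4⟩ := rot_basic S (by simpa using hE1 0 (by omega) : En lam z ≤ h + 1)
  have r4 := abs_le.1 r4
  have hz' := abs_le.1 hz
  have hDz : Dg z = z.1 - z.2 := rfl
  set δ := η + (2*R+3)*(lam*(5*R+4)) with hδ
  have hδ0 : 0 ≤ δ := by positivity
  have x0neg : ((Fe lam ^ (4*0+1)) z).1 < 0 := by rw [f0]; simp only; omega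
  have x0negr : lam * (((Fe lam ^ (4*0+1)) z).1:ℝ) ≤ 0 :=
    mul_nonpos_of_nonneg_of_nonpos l0.le (by exact_mod_cast x0neg.le)
  have X0 : lam * (((Fe lam ^ (4*0+1)) z).1:ℝ) ≤ s + δ := by
    rcases le_or_gt 0 s with hs | hs
    · linarith
    · obtain ⟨c1, c2⟩ := hb (4*0+1) (by omega)
      have e := hEn (4*0+1) (by omega)
      rw [En_eq] at e
      have hsum : |((Fe lam ^ (4*0+1)) z).1 + ((Fe lam ^ (4*0+1)) z).2| ≤ 5*R+4 := by
        rw [f0, abs_le]; constructor <;> simp only <;> omega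
      have hsum' : |(((Fe lam ^ (4*0+1)) z).1:ℝ) + ((Fe lam ^ (4*0+1)) z).2| ≤ 5*R+4 := by
        exact_mod_cast hsum
      have := edge (R := R) (a := -(lam * (((Fe lam ^ (4*0+1)) z).1:ℝ)))
        (b := lam * (((Fe lam ^ (4*0+1)) z).2:ℝ)) (s := -s) (t := t) (κ := lam*(5*R+4))
        (by linarith) (by rwa [abs_neg]) c2
        (by
          rw [show -(lam * (((Fe lam ^ (4*0+1)) z).1:ℝ)) - lam * (((Fe lam ^ (4*0+1)) z).2:ℝ)
            = -(lam * ((((Fe lam ^ (4*0+1)) z).1:ℝ) + ((Fe lam ^ (4*0+1)) z).2)) by ring,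
            abs_neg, abs_mul, abs_of_pos l0]
          exact mul_le_mul_of_nonneg_left hsum' l0.le)
        hη0 (by rw [Pfun_neg]; exact e) (by rw [Pfun_neg]; exact hst) (by linarith)
        (by rw [← abs_of_neg hs]; exact hle)
      linarith
  -- last point
  have gK := (hG K le_rfl).1.ge S
  obtain ⟨a1, a2, a3, -⟩ := mono_fwd S (hE1 (4*K+1) (by omega)) (by omega)
  rw [← Fe_pow_add, show 4*K+1+4 = 4*K+5 by ring] at a1 a2 a3
  rw [abs_le] at a3
  have nK := (hG K le_rfl).2
  have hDK : Dg ((Fe lam ^ (4*K+1)) z) = ((Fe lam ^ (4*K+1)) z).1 - ((Fe lam ^ (4*K+1)) z).2 := rfl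
  have hDK' : Dg ((Fe lam ^ (4*K+5)) z) = ((Fe lam ^ (4*K+5)) z).1 - ((Fe lam ^ (4*K+5)) z).2 := rfl
  have xKpos : 0 < ((Fe lam ^ (4*K+1)) z).1 := by omega
  have xKposr : 0 ≤ lam * (((Fe lam ^ (4*K+1)) z).1:ℝ) :=
    mul_nonneg l0.le (by exact_mod_cast xKpos.le)
  have XK : s - δ ≤ lam * (((Fe lam ^ (4*K+1)) z).1:ℝ) := by
    rcases le_or_gt s 0 with hs | hs
    · linarith
    · obtain ⟨c1, c2⟩ := hb (4*K+1) (by omega)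
      have e := hEn (4*K+1) (by omega)
      rw [En_eq] at e
      have hsum : |((Fe lam ^ (4*K+1)) z).1 - ((Fe lam ^ (4*K+1)) z).2| ≤ 5*R+4 := by
        rw [abs_le]; constructor <;> omega
      have hsum' : |(((Fe lam ^ (4*K+1)) z).1:ℝ) - ((Fe lam ^ (4*K+1)) z).2| ≤ 5*R+4 := by
        exact_mod_cast hsum
      have := edge (R := R) (a := lam * (((Fe lam ^ (4*K+1)) z).1:ℝ))
        (b := lam * (((Fe lam ^ (4*K+1)) z).2:ℝ)) (s := s) (t := t) (κ := lam*(5*R+4))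
        xKposr c1 c2
        (by
          rw [← mul_sub, abs_mul, abs_of_pos l0]
          exact mul_le_mul_of_nonneg_left hsum' l0.le)
        hη0 e hst hs.le ((le_abs_self s).trans hle)
      linarith
  have hK0 : K ≠ 0 := by
    rintro rfl
    omega
  have hlr : 0 ≤ lam*(2*R+2) := by positivity
  have key : ∃ k < K, |lam * (((Fe lam ^ (4*k+1)) z).1:ℝ) - s| ≤ δ2 := by
    classical
    have hex : ∃ k, s - δ ≤ lam * (((Fe lam ^ (4*k+1)) z).1:ℝ) := ⟨K, XK⟩
    have hf := Nat.find_spec hex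
    have hfK : Nat.find hex ≤ K := Nat.find_min' hex XK
    rcases hk : Nat.find hex with _ | k
    · rw [hk] at hf
      refine ⟨0, by omega, ?_⟩
      rw [abs_le]; constructor <;> linarith
    · rw [hk] at hf hfK
      have hm := Nat.find_min hex (m := k) (by omega)
      push Not at hm
      refine ⟨k, by omega, ?_⟩
      have gk := (hG k (by omega)).1.ge S
      obtain ⟨-, b2, -, -⟩ := mono_fwd S (hE1 (4*k+1) (by omega)) (by omega)
      rw [← Fe_pow_add, show 4*k+1+4 = 4*(k+1)+1 by ring] at b2
      have b2r : (((Fe lam ^ (4*(k+1)+1)) z).1:ℝ) ≤ ((Fe lam ^ (4*k+1)) z).1 + (2*R+2) := by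
        exact_mod_cast b2
      have b3 := mul_le_mul_of_nonneg_left b2r l0.le
      rw [mul_add lam] at b3
      rw [abs_le]; constructor <;> linarith
  obtain ⟨k, hk, hX⟩ := key
  have hδ20 : 0 ≤ δ2 := (abs_nonneg _).trans hX
  have hle3 : δ2 ≤ δ3 := by rw [hδ3]; nlinarith
  refine ⟨k, hk, hX.trans hle3, ?_⟩
  have gk := (hG k hk.le).1
  have cp := S.cpos
  have ht0 : 0 ≤ t := (abs_nonneg s).trans hle
  have ps := abs_le_Pfun s
  have pt' := abs_le_Pfun t
  rw [abs_of_nonneg ht0] at pt'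
  have hhR := S.hR
  have hP := Pfun_lip (hb (4*k+1) (by omega)).1 (by linarith : |s| ≤ R + 1)
  have hP2 : (2*R+3)*|lam * (((Fe lam ^ (4*k+1)) z).1:ℝ) - s| ≤ (2*R+3)*δ2 :=
    mul_le_mul_of_nonneg_left hX (by positivity)
  have hP' := abs_le.1 (hP.trans hP2)
  have e := abs_le.1 (hEn (4*k+1) (by omega))
  rw [En_eq] at e
  refine (abs_sub_le_Pfun ht0 (by linarith [gk.hYc])).trans ?_
  rw [abs_le]; constructor <;> linarith

lemma rot_dist {h : ℝ} {R : ℕ} {lam : ℝ} (S : SmallPar h R lam) {p : ℤ × ℤ}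
    (hE : En lam p ≤ h + 1) {s t D : ℝ} (h1 : |lam * (p.1:ℝ) - s| ≤ D)
    (h2 : |lam * (p.2:ℝ) - t| ≤ D) :
    |lam * ((Fe lam p).1:ℝ) - (-t)| ≤ D + lam * R ∧
    |lam * ((Fe lam p).2:ℝ) - s| ≤ D + lam * R := by
  obtain ⟨r1, r2, -, -⟩ := rot_basic S hE
  have : 0 ≤ lam * R := mul_nonneg S.lpos.le (by positivity)
  rw [r1]
  refine ⟨?_, by linarith⟩
  rw [abs_le] at *
  constructor <;> linarith

lemma cover {h : ℝ} {R : ℕ} {lam η : ℝ} (S : SmallPar h R lam) {z : ℤ × ℤ} {K : ℕ}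
    (hz : |Dg z| ≤ 2*(2*R+2)) (hz1 : 2*(2*R+2) ≤ z.1) (hz2 : 2*(2*R+2) ≤ z.2)
    (hη0 : 0 ≤ η) (hη : η ≤ 1/2)
    (hEn : ∀ i ≤ 4*K+5, |En lam ((Fe lam ^ i) z) - h| ≤ η)
    (hG : ∀ k ≤ K, Good h R lam ((Fe lam ^ (4*k+1)) z) ∧ Dg ((Fe lam ^ (4*k+1)) z) < 0)
    (hD : 0 ≤ Dg ((Fe lam ^ (4*K+5)) z)) {ξ : ℝ × ℝ} (hξ : ham ξ = h)
    {δ2 δ3 : ℝ} (hδ2 : δ2 = η + (2*R+3)*(lam*(5*R+4)) + lam*(2*R+2))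
    (hδ3 : δ3 = η + (2*R+3)*δ2) :
    ∃ i ≤ 4*K, dist ξ (pt lam ((Fe lam ^ i) z)) ≤ δ3 + 3 * (lam * R) := by
  obtain ⟨s, t⟩ := ξ
  have hst : Pfun s + Pfun t = h := hξ
  have hlR : 0 ≤ lam * R := mul_nonneg S.lpos.le (by positivity)
  have hE1 : ∀ i ≤ 4*K+5, En lam ((Fe lam ^ i) z) ≤ h + 1 := by
    intro i hi
    have := (abs_le.1 (hEn i hi)).2
    linarith
  have fin : ∀ i ≤ 4*K, ∀ D ≤ δ3 + 3 * (lam * R),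
      |lam * (((Fe lam ^ i) z).1:ℝ) - s| ≤ D → |lam * (((Fe lam ^ i) z).2:ℝ) - t| ≤ D →
      ∃ i ≤ 4*K, dist (s, t) (pt lam ((Fe lam ^ i) z)) ≤ δ3 + 3 * (lam * R) := by
    intro i hi D hDle h1 h2
    refine ⟨i, hi, ?_⟩
    rw [dist_comm, Prod.dist_eq]
    exact max_le (h1.trans hDle) (h2.trans hDle)
  have top : ∀ {s t : ℝ}, Pfun s + Pfun t = h → |s| ≤ t → ∃ k < K,
      |lam * (((Fe lam ^ (4*k+1)) z).1:ℝ) - s| ≤ δ3 ∧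
      |lam * (((Fe lam ^ (4*k+1)) z).2:ℝ) - t| ≤ δ3 := fun h1 h2 =>
    cover_top S hz hz1 hz2 hη0 hη hEn hG hD h1 h2 hδ2 hδ3
  rcases le_or_gt |s| |t| with hc | hc
  · rcases le_or_gt 0 t with ht | ht
    · rw [abs_of_nonneg ht] at hc
      obtain ⟨k, hk, u1, u2⟩ := top hst hc
      exact fin (4*k+1) (by omega) δ3 (by linarith) u1 u2
    · rw [abs_of_neg ht] at hc
      obtain ⟨k, hk, u1, u2⟩ := top (s := -s) (t := -t) (by rw [Pfun_neg, Pfun_neg]; exact hst)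
        (by rwa [abs_neg])
      obtain ⟨v1, v2⟩ := rot_dist S (hE1 _ (by omega)) u1 u2
      rw [← Fe_pow_succ] at v1 v2
      obtain ⟨w1, w2⟩ := rot_dist S (hE1 _ (by omega)) v1 v2
      rw [← Fe_pow_succ] at w1 w2
      rw [neg_neg] at w1 w2
      exact fin (4*k+1+1+1) (by omega) _ (by linarith) w1 w2
  · rcases le_or_gt 0 s with hs | hs
    · rw [abs_of_nonneg hs] at hc
      obtain ⟨k, hk, u1, u2⟩ := top (s := -t) (t := s) (by rw [Pfun_neg]; linarith)
        (by rw [abs_neg]; exact hc.le)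
      obtain ⟨v1, v2⟩ := rot_dist S (hE1 _ (by omega)) u1 u2
      rw [← Fe_pow_succ] at v1 v2
      obtain ⟨w1, w2⟩ := rot_dist S (hE1 _ (by omega)) v1 v2
      rw [← Fe_pow_succ] at w1 w2
      rw [neg_neg] at w1
      obtain ⟨x1, x2⟩ := rot_dist S (hE1 _ (by omega)) w1 w2
      rw [← Fe_pow_succ] at x1 x2
      rw [neg_neg] at x1
      exact fin (4*k+1+1+1+1) (by omega) _ (by linarith) x1 x2
    · rw [abs_of_neg hs] at hc
      obtain ⟨k, hk, u1, u2⟩ := top (s := t) (t := -s) (by rw [Pfun_neg]; linarith) hc.le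
      obtain ⟨v1, v2⟩ := rot_dist S (hE1 _ (by omega)) u1 u2
      rw [← Fe_pow_succ] at v1 v2
      rw [neg_neg] at v1
      exact fin (4*k+1+1) (by omega) _ (by linarith) v1 v2

/-! ### Assembly -/

lemma main_bound {h : ℝ} {R : ℕ} {lam Ce Ct : ℝ} (w : ℝ × ℝ) (hw : ham w = h)
    (hCe : Ce = 2*(2*R+3) + 4 * Kc R)
    (hCt : Ct = Ce + (2*R+3)*(Ce + (2*R+3)*(5*R+4) + (2*R+2)) + 3*R)
    (h0 : 0 < h) (hR : h + 2 ≤ R) (hl : 0 < lam) (hl1 : lam * Ce ≤ h/100)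
    (hl2 : lam * Ce ≤ 1/100) :
    Metric.hausdorffDist {ξ : ℝ × ℝ | ham ξ = ham w}
      (pt lam '' retOrbit lam (Rlam lam w)) ≤ lam * Ct := by
  have hR0 : (0:ℝ) ≤ R := by positivity
  have hC1 := C1_nonneg R
  have hKc : 0 ≤ Kc R := by unfold Kc; positivity
  have hlK : 0 ≤ lam * Kc R := by positivity
  have hlC : lam * Ce = 2 * (2*R+3) * lam + 4 * (lam * Kc R) := by rw [hCe]; ring
  have hlε : 0 ≤ 2 * (2*R+3) * lam := by positivity
  have S : SmallPar h R lam := ⟨h0, hR, hl, by linarith, by linarith⟩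
  set p := Rlam lam w with hp
  -- energy of the starting point
  have fl : ∀ x : ℝ, |x| ≤ R - 2 → |Pfun (lam * (⌊x/lam⌋:ℝ)) - Pfun x| ≤ (2*R+3) * lam := by
    intro x hx
    have h1 : lam * (⌊x/lam⌋:ℝ) ≤ x := by
      have := mul_le_mul_of_nonneg_left (Int.floor_le (x/lam)) hl.le
      rwa [mul_div_cancel₀ _ hl.ne'] at this
    have h2 : x < lam * (⌊x/lam⌋:ℝ) + lam := by
      have := mul_lt_mul_of_pos_left (Int.lt_floor_add_one (x/lam)) hl
      rw [mul_div_cancel₀ _ hl.ne'] at this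
      linarith
    have hx' := abs_le.1 hx
    have hl3 : lam ≤ 1 := by nlinarith
    refine (Pfun_lip (R := R) ?_ ?_).trans ?_
    · rw [abs_le]; constructor <;> linarith
    · linarith
    · apply mul_le_mul_of_nonneg_left _ (by positivity)
      rw [abs_le]; constructor <;> linarith
  have hE0 : |En lam p - h| ≤ 2 * (2*R+3) * lam := by
    have q1 := abs_le_Pfun w.1
    have q2 := abs_le_Pfun w.2
    have q3 := abs_nonneg w.1
    have q4 := abs_nonneg w.2
    have hw' : Pfun w.1 + Pfun w.2 = h := hw
    have f1 := abs_le.1 (fl w.1 (by linarith))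
    have f2 := abs_le.1 (fl w.2 (by linarith))
    have : En lam p = Pfun (lam * (⌊w.1/lam⌋:ℝ)) + Pfun (lam * (⌊w.2/lam⌋:ℝ)) := rfl
    rw [this, abs_le]; constructor <;> linarith
  obtain ⟨n, hn, hnE⟩ := backward S (by linarith) (by linarith) hE0
  -- the backward visit
  obtain ⟨m, hm⟩ : ∃ m, m = tauMinus lam p := ⟨_, rfl⟩
  have hmX : (Fe lam ^ (-(m:ℤ))) p ∈ Xset lam := by
    rw [hm]; exact Nat.sInf_mem (s := {k : ℕ | (Fe lam ^ (-(k : ℤ))) p ∈ Xset lam}) ⟨n, hn⟩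
  have hmn : m ≤ n := by rw [hm]; exact Nat.sInf_le hn
  have hmin : ∀ k < m, (Fe lam ^ (-(k:ℤ))) p ∉ Xset lam := by
    intro k hk
    rw [hm] at hk
    exact Nat.notMem_of_lt_sInf hk
  obtain ⟨z, hz⟩ : ∃ z, z = (Fe lam ^ (-(m:ℤ))) p := ⟨_, rfl⟩
  have shift : ∀ (i : ℕ) (k : ℤ), k + m = i → (Fe lam ^ k) p = (Fe lam ^ i) z := by
    intro i k hik
    rw [hz, ← zpow_natCast, ← Equiv.Perm.mul_apply, ← zpow_add]
    congr 2; omega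
  rw [← hz] at hmX
  have hzE := hnE m hmn
  rw [← hz] at hzE
  have hzE' := abs_le.1 hzE
  obtain ⟨n1, n2, n3⟩ := X_near S hmX (by linarith) (by linarith)
  obtain ⟨K, hEn, hXX, hnX, hG, hD⟩ := consec S hmX (by linarith) (by linarith) hzE
  have hη : 2 * (2*R+3) * lam + lam * (2 * Kc R) + lam * (2 * Kc R) = lam * Ce := by
    rw [hlC]; ring
  rw [hη] at hEn
  -- the forward visit
  have hlow : ∀ i, 1 ≤ i → i ≤ m → (Fe lam ^ i) z ∉ Xset lam := by
    intro i hi him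
    rw [← shift i (-((m-i:ℕ):ℤ)) (by omega)]
    exact hmin _ (by omega)
  obtain ⟨N, hN1, hN2⟩ : ∃ N, (Fe lam ^ N) z ∈ Xset lam ∧ (N = 4*K+1 ∨ N = 4*K+5) := by
    rcases hXX with hX | hX
    · exact ⟨_, hX, Or.inl rfl⟩
    · exact ⟨_, hX, Or.inr rfl⟩
  have hNm : m < N := by
    by_contra hcon
    exact hlow N (by omega) (by omega) hN1
  obtain ⟨τ, hτ⟩ : ∃ τ, τ = tauPlus lam p := ⟨_, rfl⟩
  have hmem : (N - m) ∈ {k : ℕ | 1 ≤ k ∧ (Fe lam ^ (k : ℤ)) p ∈ Xset lam} := by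
    refine ⟨by omega, ?_⟩
    rw [shift N ((N-m:ℕ):ℤ) (by omega)]
    exact hN1
  have hτle : τ ≤ N - m := by rw [hτ]; exact Nat.sInf_le hmem
  have hτmem : 1 ≤ τ ∧ (Fe lam ^ (τ : ℤ)) p ∈ Xset lam := by
    rw [hτ]; exact Nat.sInf_mem ⟨_, hmem⟩
  have hτge : 4*K+1 ≤ τ + m := by
    by_contra hcon
    have := hτmem.2
    rw [shift (τ+m) τ (by omega)] at this
    exact hnX (τ+m) (by omega) (by omega) this
  have hCt0 : lam * Ce ≤ lam * Ct := by
    apply mul_le_mul_of_nonneg_left _ hl.le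
    have : 0 ≤ Ce := by rw [hCe]; positivity
    rw [hCt]
    have : 0 ≤ (2*R+3)*(Ce + (2*R+3)*(5*R+4) + (2*R+2)) + 3*R := by positivity
    linarith
  have hCe0 : 0 ≤ lam * Ce := by linarith
  apply Metric.hausdorffDist_le_of_mem_dist (by linarith)
  · intro ξ hξ
    have hξ' : ham ξ = h := by rw [← hw]; exact hξ
    obtain ⟨i, hi, hd⟩ := cover S n1 n2 n3 hCe0 (by linarith) hEn hG hD hξ' rfl rfl
    refine ⟨pt lam ((Fe lam ^ i) z), ⟨_, ⟨(i:ℤ) - m, ?_, ?_, ?_⟩, rfl⟩, ?_⟩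
    · rw [← hm]; omega
    · rw [← hτ]; omega
    · rw [shift i _ (by omega)]
    · refine hd.trans (le_of_eq ?_)
      rw [hCt]; ring
  · rintro q ⟨_, ⟨k, hk1, hk2, rfl⟩, rfl⟩
    rw [← hm] at hk1
    rw [← hτ] at hk2
    obtain ⟨i, hi⟩ : ∃ i : ℕ, k + m = i := ⟨(k+m).toNat, by omega⟩
    rw [shift i k hi]
    obtain ⟨ξ, x1, x2⟩ := near_level hCe0 (by linarith) _ (hEn i (by omega))
    exact ⟨ξ, by rw [← hw] at x1; exact x1, x2.trans hCt0⟩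

theorem hausdorffDist_tendsto_zero (w : ℝ × ℝ) (hw : w ≠ 0) :
    Tendsto
      (fun lam => Metric.hausdorffDist
        {ξ : ℝ × ℝ | ham ξ = ham w}
        (pt lam '' retOrbit lam (Rlam lam w)))
      (nhdsWithin 0 (Set.Ioi 0)) (nhds 0) := by
  have hh : 0 < ham w := by
    have h1 := abs_le_Pfun w.1
    have h2 := abs_le_Pfun w.2
    have h3 := abs_nonneg w.1
    have h4 := abs_nonneg w.2
    have e : ham w = Pfun w.1 + Pfun w.2 := rfl
    by_contra hcon
    apply hw
    have a1 : |w.1| = 0 := by linarith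
    have a2 : |w.2| = 0 := by linarith
    exact Prod.ext (abs_eq_zero.1 a1) (abs_eq_zero.1 a2)
  obtain ⟨R, hR⟩ := exists_nat_ge (ham w + 2)
  obtain ⟨Ce, hCe⟩ : ∃ Ce : ℝ, Ce = 2*(2*R+3) + 4 * Kc R := ⟨_, rfl⟩
  obtain ⟨Ct, hCt⟩ : ∃ Ct : ℝ, Ct = Ce + (2*R+3)*(Ce + (2*R+3)*(5*R+4) + (2*R+2)) + 3*R :=
    ⟨_, rfl⟩
  have lim : ∀ C : ℝ, Tendsto (fun lam : ℝ => lam * C) (nhdsWithin 0 (Set.Ioi 0)) (nhds 0) := by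
    intro C
    have : Tendsto (fun lam : ℝ => lam * C) (nhds 0) (nhds (0 * C)) :=
      (continuous_id.mul continuous_const).tendsto 0
    rw [zero_mul] at this
    exact this.mono_left nhdsWithin_le_nhds
  refine tendsto_of_tendsto_of_tendsto_of_le_of_le' tendsto_const_nhds (lim Ct)
    (Eventually.of_forall fun _ => Metric.hausdorffDist_nonneg) ?_
  filter_upwards [self_mem_nhdsWithin,
    (lim Ce).eventually_le_const (by positivity : 0 < ham w / 100),
    (lim Ce).eventually_le_const (by norm_num : (0:ℝ) < 1/100)] with lam h1 h2 h3
  exact main_bound w rfl hCe hCt hh hR h1 h2 h3
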